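/- arXiv:0809.3845 — 2 statements merged into one kernel-verified Lean document; each statement's English description precedes it below -/
import Mathlib

section
/- Let N > 0, let ā ∈ ℝ and let ζ ∈ {−1, +1}. Assume that for all a with ζ(a − ā) > 0 sufficiently small, the set {r > 0 : φ_a(r) = 0} is nonempty and bounded, so that the largest zero r(a) := max{r > 0 : φ_a(r) = 0} is well defined, and assume lim_{a→ā, ζ(a−ā)>0} r(a) = ∞. Then there exists ε > 0 such that on the one-sided interval I := (ā − ε, ā) if ζ = −1, I := (ā, ā + ε) if ζ = +1, the function a ↦ r(a) is differentiable with r'(a) = − (4 / ( r(a) |φ_a'(r(a))|² )) ∫₀^{r(a)} (1+r²)^N e^{2u_a(r)} φ_a(r)³ r dr; moreover, if J_N(ā) ≠ 0, then r'(a) · J_N(a) < 0 for all a ∈ I. -/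
open Real Set MeasureTheory Filter

noncomputable section

/-- `u` is a radial solution of the Liouville equation
`u'' + u'/r + (1+r²)^N e^{2u} = 0` on `(0,∞)`, of class `C²` on `[0,∞)`,
with `u'(0) = 0` and finite mass `∫₀^∞ (1+r²)^N e^{2u} r dr < ∞`. -/
def IsSol (N : ℝ) (u : ℝ → ℝ) : Prop :=
  ContDiffOn ℝ 2 u (Ici 0) ∧
  (∀ r : ℝ, 0 < r →
    deriv (deriv u) r + deriv u r / r + (1 + r ^ 2) ^ N * Real.exp (2 * u r) = 0) ∧
  derivWithin u (Ici 0) 0 = 0 ∧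
  IntegrableOn (fun r => (1 + r ^ 2) ^ N * Real.exp (2 * u r) * r) (Ioi 0)

/-- `φ` solves the linearized equation `φ'' + φ'/r + 2(1+r²)^N e^{2u} φ = 0` on `(0,∞)`,
is `C²` on `[0,∞)`, with `φ(0) = 1` and `φ'(0) = 0`. -/
def IsLin (N : ℝ) (u φ : ℝ → ℝ) : Prop :=
  ContDiffOn ℝ 2 φ (Ici 0) ∧
  (∀ r : ℝ, 0 < r →
    deriv (deriv φ) r + deriv φ r / r
      + 2 * (1 + r ^ 2) ^ N * Real.exp (2 * u r) * φ r = 0) ∧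
  φ 0 = 1 ∧ derivWithin φ (Ici 0) 0 = 0

/-- `J_N(a) = ∫₀^∞ (1+r²)^N e^{2u_a} φ_a³ r dr`. -/
def JN (N : ℝ) (u φ : ℝ → ℝ) : ℝ :=
  ∫ r in Ioi (0:ℝ), (1 + r ^ 2) ^ N * Real.exp (2 * u r) * (φ r) ^ 3 * r

/-- The nonlinearity `(1 + r²)^N e^{2u}`. -/
def liouvilleDensity (N : ℝ) (u : ℝ → ℝ) (r : ℝ) : ℝ :=
  (1 + r ^ 2) ^ N * Real.exp (2 * u r)

/-- `w` solves `w'' + w'/r + h = 0` on `(0,∞)` with `w' = p` and `p(0) = 0`. -/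
structure RadialODE (w p h : ℝ → ℝ) : Prop where
  cont : ContinuousOn w (Ici 0)
  cont_deriv : ContinuousOn p (Ici 0)
  deriv_zero : p 0 = 0
  hasDerivAt : ∀ r, 0 < r → HasDerivAt w (p r) r
  hasDerivAt_deriv : ∀ r, 0 < r → HasDerivAt p (-p r / r - h r) r

lemma RadialODE.of_contDiffOn {w h : ℝ → ℝ} (hw : ContDiffOn ℝ 2 w (Ici 0))
    (hode : ∀ r : ℝ, 0 < r → deriv (deriv w) r + deriv w r / r + h r = 0)
    (h0 : derivWithin w (Ici 0) 0 = 0) :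
    RadialODE w (derivWithin w (Ici 0)) h := by
  have hD : ContDiffOn ℝ 1 (derivWithin w (Ici 0)) (Ici 0) :=
    hw.derivWithin (uniqueDiffOn_Ici 0) (by norm_num)
  have heq : ∀ r : ℝ, 0 < r → derivWithin w (Ici 0) r = deriv w r := fun r hr =>
    derivWithin_of_mem_nhds (Ici_mem_nhds hr)
  refine ⟨hw.continuousOn, hD.continuousOn, h0, fun r hr => ?_, fun r hr => ?_⟩
  · rw [heq r hr]
    exact ((hw.contDiffAt (Ici_mem_nhds hr)).differentiableAt (by norm_num)).hasDerivAt
  · have h1 := ((hD.contDiffAt (Ici_mem_nhds hr)).differentiableAt (by norm_num)).hasDerivAt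
    have h2 : derivWithin w (Ici 0) =ᶠ[nhds r] deriv w := by
      filter_upwards [lt_mem_nhds hr] with x hx using heq x hx
    rw [h2.deriv_eq] at h1
    rw [heq r hr]
    have h3 := hode r hr
    exact h1.congr_deriv (by rw [neg_div]; linarith)

lemma RadialODE.sub {w p h w' p' h' : ℝ → ℝ} (H : RadialODE w p h) (H' : RadialODE w' p' h') :
    RadialODE (fun r => w r - w' r) (fun r => p r - p' r) (fun r => h r - h' r) where
  cont := H.cont.sub H'.cont
  cont_deriv := H.cont_deriv.sub H'.cont_deriv
  deriv_zero := by simp [H.deriv_zero, H'.deriv_zero]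
  hasDerivAt r hr := (H.hasDerivAt r hr).sub (H'.hasDerivAt r hr)
  hasDerivAt_deriv r hr :=
    ((H.hasDerivAt_deriv r hr).sub (H'.hasDerivAt_deriv r hr)).congr_deriv (by ring)

lemma RadialODE.const_mul {w p h : ℝ → ℝ} (H : RadialODE w p h) (c : ℝ) :
    RadialODE (fun r => c * w r) (fun r => c * p r) (fun r => c * h r) where
  cont := continuousOn_const.mul H.cont
  cont_deriv := continuousOn_const.mul H.cont_deriv
  deriv_zero := by simp [H.deriv_zero]
  hasDerivAt r hr := (H.hasDerivAt r hr).const_mul c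
  hasDerivAt_deriv r hr :=
    ((H.hasDerivAt_deriv r hr).const_mul c).congr_deriv (by ring)

lemma RadialODE.energy_le {w p h : ℝ → ℝ} (H : RadialODE w p h) {L e X : ℝ} (hL : 0 ≤ L)
    (hh : ∀ r ∈ Ioo 0 X, |h r| ≤ L * |w r| + e) {r : ℝ} (hr : r ∈ Icc 0 X) :
    w r ^ 2 + p r ^ 2 ≤ (w 0 ^ 2 + e ^ 2) * Real.exp ((2 + L) * X) := by
  have hsub : Icc 0 X ⊆ Ici (0 : ℝ) := fun x hx => hx.1
  have hanti : AntitoneOn (fun r => (w r ^ 2 + p r ^ 2 + e ^ 2) * Real.exp (-(2 + L) * r))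
      (Icc 0 X) := by
    refine antitoneOn_of_hasDerivWithinAt_nonpos (convex_Icc 0 X)
      (f' := fun r => (2 * w r * p r + 2 * p r * (-p r / r - h r)
        - (2 + L) * (w r ^ 2 + p r ^ 2 + e ^ 2)) * Real.exp (-(2 + L) * r)) ?_ ?_ ?_
    · exact (((H.cont.mono hsub).pow 2).add ((H.cont_deriv.mono hsub).pow 2)
        |>.add continuousOn_const).mul (by fun_prop)
    · intro x hx
      rw [interior_Icc] at hx
      have h1 := (((H.hasDerivAt x hx.1).pow 2).add
        ((H.hasDerivAt_deriv x hx.1).pow 2)).add_const (e ^ 2)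
      have h2 := ((hasDerivAt_id x).const_mul (-(2 + L))).exp
      refine (h1.mul h2).hasDerivWithinAt.congr_deriv ?_
      simp
      ring
    · intro x hx
      rw [interior_Icc] at hx
      refine mul_nonpos_of_nonpos_of_nonneg ?_ (Real.exp_pos _).le
      have hb := hh x hx
      have h1 : 0 ≤ p x ^ 2 / x := div_nonneg (sq_nonneg _) hx.1.le
      have h2 : -(p x * h x) ≤ |p x| * (L * |w x| + e) := by
        calc -(p x * h x) ≤ |p x * h x| := neg_le_abs _
          _ = |p x| * |h x| := abs_mul _ _
          _ ≤ _ := by gcongr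
      have h3 : 2 * |p x| * |w x| ≤ w x ^ 2 + p x ^ 2 := by
        nlinarith [sq_nonneg (|p x| - |w x|), sq_abs (p x), sq_abs (w x)]
      have h4 : 2 * w x * p x ≤ w x ^ 2 + p x ^ 2 := by nlinarith [sq_nonneg (w x - p x)]
      have h5 : 2 * |p x| * e ≤ p x ^ 2 + e ^ 2 := by
        nlinarith [sq_nonneg (|p x| - e), sq_abs (p x)]
      have h6 := mul_le_mul_of_nonneg_left h3 hL
      have h7 : p x * (-p x / x) = -(p x ^ 2 / x) := by ring
      nlinarith [sq_nonneg (w x), sq_nonneg e, mul_nonneg hL (sq_nonneg e)]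
  have hX : (0 : ℝ) ≤ X := hr.1.trans hr.2
  have h1 := hanti (left_mem_Icc.2 hX) hr hr.1
  simp only [H.deriv_zero, mul_zero, Real.exp_zero, mul_one, ne_eq, OfNat.ofNat_ne_zero,
    not_false_eq_true, zero_pow, add_zero] at h1
  have h2 : w r ^ 2 + p r ^ 2 + e ^ 2 ≤ (w 0 ^ 2 + e ^ 2) * Real.exp ((2 + L) * r) := by
    have := mul_le_mul_of_nonneg_right h1 (Real.exp_pos ((2 + L) * r)).le
    rw [mul_assoc, ← Real.exp_add, show -(2 + L) * r + (2 + L) * r = 0 by ring,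
      Real.exp_zero, mul_one] at this
    exact this
  have h3 : Real.exp ((2 + L) * r) ≤ Real.exp ((2 + L) * X) := by
    gcongr
    exact hr.2
  nlinarith [sq_nonneg e, mul_le_mul_of_nonneg_left h3
    (add_nonneg (sq_nonneg (w 0)) (sq_nonneg e))]

lemma RadialODE.abs_le_exp {w p h : ℝ → ℝ} (H : RadialODE w p h) {L e X : ℝ} (hL : 0 ≤ L)
    (he : 0 ≤ e) (hh : ∀ r ∈ Ioo 0 X, |h r| ≤ L * |w r| + e) {r : ℝ} (hr : r ∈ Icc 0 X) :
    |w r| ≤ (|w 0| + e) * Real.exp ((2 + L) * X) ∧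
      |p r| ≤ (|w 0| + e) * Real.exp ((2 + L) * X) := by
  have hE := H.energy_le hL hh hr
  have hX : (0 : ℝ) ≤ X := hr.1.trans hr.2
  have h1 : 1 ≤ Real.exp ((2 + L) * X) := Real.one_le_exp (by positivity)
  have h0 : 0 ≤ (|w 0| + e) * Real.exp ((2 + L) * X) := by positivity
  have h2 : (w 0 ^ 2 + e ^ 2) * Real.exp ((2 + L) * X) ≤
      ((|w 0| + e) * Real.exp ((2 + L) * X)) ^ 2 := by
    rw [mul_pow]
    have h3 : w 0 ^ 2 + e ^ 2 ≤ (|w 0| + e) ^ 2 := by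
      nlinarith [sq_abs (w 0), mul_nonneg (abs_nonneg (w 0)) he]
    have h4 : Real.exp ((2 + L) * X) ≤ Real.exp ((2 + L) * X) ^ 2 := by nlinarith
    gcongr
  constructor
  · exact abs_le_of_sq_le_sq (by nlinarith [sq_nonneg (p r)]) h0
  · exact abs_le_of_sq_le_sq (by nlinarith [sq_nonneg (w r)]) h0

lemma abs_exp_sub_exp_le {x y M : ℝ} (hx : x ≤ M) (hy : y ≤ M) :
    |Real.exp x - Real.exp y| ≤ Real.exp M * |x - y| := by
  have key : ∀ x y : ℝ, x ≤ M → Real.exp x - Real.exp y ≤ Real.exp M * |x - y| := by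
    intro x y hx
    have h1 := Real.add_one_le_exp (y - x)
    have h2 : Real.exp y = Real.exp x * Real.exp (y - x) := by rw [← Real.exp_add]; ring_nf
    have h3 : Real.exp x ≤ Real.exp M := Real.exp_le_exp.2 hx
    calc Real.exp x - Real.exp y ≤ Real.exp x * (x - y) := by
          rw [h2]; nlinarith [Real.exp_pos x]
      _ ≤ Real.exp x * |x - y| := by gcongr; exact le_abs_self _
      _ ≤ _ := by gcongr
  refine abs_le.2 ⟨?_, key x y hx⟩
  have := key y x hy
  rw [abs_sub_comm] at this
  linarith

/-- A family of solutions of the Liouville equation with `u_a(0) = a`, together with the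
solutions of the linearized equations; `p` and `s` are the radial derivatives. -/
structure LiouvilleFamily (N : ℝ) (u p φ s : ℝ → ℝ → ℝ) : Prop where
  sol : ∀ a, RadialODE (u a) (p a) (liouvilleDensity N (u a))
  sol_zero : ∀ a, u a 0 = a
  lin : ∀ a, RadialODE (φ a) (s a) (fun r => 2 * liouvilleDensity N (u a) r * φ a r)
  lin_zero : ∀ a, φ a 0 = 1

lemma liouvilleDensity_pos (N : ℝ) (u : ℝ → ℝ) (r : ℝ) : 0 < liouvilleDensity N u r :=
  mul_pos (Real.rpow_pos_of_pos (by positivity) _) (Real.exp_pos _)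

lemma RadialODE.antitoneOn_mul {w p h : ℝ → ℝ} (H : RadialODE w p h)
    (hpos : ∀ r, 0 < r → 0 ≤ h r) : AntitoneOn (fun r => r * p r) (Ici 0) := by
  refine antitoneOn_of_hasDerivWithinAt_nonpos (convex_Ici 0) (f' := fun r => -(r * h r))
    (continuousOn_id.mul H.cont_deriv) ?_ ?_
  · intro x hx
    rw [interior_Ici] at hx
    have hx' : x ≠ 0 := ne_of_gt hx
    refine ((hasDerivAt_id x).mul (H.hasDerivAt_deriv x hx)).hasDerivWithinAt.congr_deriv ?_
    simp
    field_simp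
    ring
  · intro x hx
    rw [interior_Ici] at hx
    exact neg_nonpos.2 (mul_nonneg (le_of_lt hx) (hpos x hx))

lemma RadialODE.antitoneOn {w p h : ℝ → ℝ} (H : RadialODE w p h)
    (hpos : ∀ r, 0 < r → 0 ≤ h r) : AntitoneOn w (Ici 0) := by
  refine antitoneOn_of_hasDerivWithinAt_nonpos (convex_Ici 0) (f' := p) H.cont ?_ ?_
  · intro x hx
    rw [interior_Ici] at hx
    exact (H.hasDerivAt x hx).hasDerivWithinAt
  · intro x hx
    rw [interior_Ici] at hx
    have hx : 0 < x := hx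
    have := H.antitoneOn_mul hpos (mem_Ici.2 le_rfl) (le_of_lt hx : (0:ℝ) ≤ x) hx.le
    simp only [zero_mul] at this
    by_contra hc
    nlinarith [mul_pos hx (not_le.1 hc)]
lemma abs_liouvilleDensity_sub_le {N : ℝ} (hN : 0 ≤ N) {v w : ℝ → ℝ} {r X M : ℝ}
    (hr : r ∈ Icc 0 X) (hv : v r ≤ M) (hw : w r ≤ M) :
    |liouvilleDensity N v r - liouvilleDensity N w r| ≤
      2 * ((1 + X ^ 2) ^ N * Real.exp (2 * M)) * |v r - w r| := by
  have h1 := abs_exp_sub_exp_le (mul_le_mul_of_nonneg_left hv zero_le_two)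
    (mul_le_mul_of_nonneg_left hw zero_le_two)
  have h2 : (1 + r ^ 2) ^ N ≤ (1 + X ^ 2) ^ N := by
    have := hr.1
    have := hr.2
    gcongr
  have h3 : |2 * v r - 2 * w r| = 2 * |v r - w r| := by
    rw [← mul_sub, abs_mul, abs_two]
  have h4 : 0 ≤ (1 + r ^ 2) ^ N := by positivity
  rw [h3] at h1
  unfold liouvilleDensity
  rw [← mul_sub, abs_mul, abs_of_nonneg h4]
  calc _ ≤ (1 + X ^ 2) ^ N * (Real.exp (2 * M) * (2 * |v r - w r|)) := by gcongr
    _ = _ := by ring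

lemma liouvilleDensity_le {N : ℝ} (hN : 0 ≤ N) {v : ℝ → ℝ} {r X M : ℝ}
    (hr : r ∈ Icc 0 X) (hv : v r ≤ M) :
    liouvilleDensity N v r ≤ (1 + X ^ 2) ^ N * Real.exp (2 * M) := by
  have := hr.1
  have := hr.2
  unfold liouvilleDensity
  gcongr

namespace LiouvilleFamily

variable {N : ℝ} {u p φ s : ℝ → ℝ → ℝ}

lemma le_init (F : LiouvilleFamily N u p φ s) (a : ℝ) {r : ℝ} (hr : 0 ≤ r) : u a r ≤ a := by
  have := (F.sol a).antitoneOn (fun r _ => (liouvilleDensity_pos N (u a) r).le)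
    (mem_Ici.2 le_rfl) hr hr
  rwa [F.sol_zero] at this

/-- Quantitative dependence of the family on the initial value, on compact intervals. -/
lemma exists_bounds (F : LiouvilleFamily N u p φ s) (hN : 0 ≤ N) (a X : ℝ) (hX : 0 ≤ X) :
    ∃ C, 0 < C ∧ ∀ b, |b - a| ≤ 1 → ∀ r ∈ Icc 0 X,
      liouvilleDensity N (u b) r ≤ C ∧
      |u b r - u a r| ≤ C * |b - a| ∧ |p b r - p a r| ≤ C * |b - a| ∧
      |liouvilleDensity N (u b) r - liouvilleDensity N (u a) r| ≤ C * |b - a| ∧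
      |φ b r| ≤ C ∧ |s b r| ≤ C ∧
      |φ b r - φ a r| ≤ C * |b - a| ∧ |s b r - s a r| ≤ C * |b - a| := by
  set K := (1 + X ^ 2) ^ N * Real.exp (2 * (a + 1)) with hK
  have hK0 : 0 < K := by positivity
  set B := Real.exp ((2 + 2 * K) * X) with hB
  have hB1 : 1 ≤ B := Real.one_le_exp (by positivity)
  have hle : ∀ b, |b - a| ≤ 1 → ∀ r ∈ Icc 0 X, u b r ≤ a + 1 := fun b hb r hr =>
    (F.le_init b hr.1).trans (by linarith [(abs_le.1 hb).2])
  have ha : |a - a| ≤ 1 := by simp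
  have hdens : ∀ b, |b - a| ≤ 1 → ∀ r ∈ Icc 0 X, liouvilleDensity N (u b) r ≤ K :=
    fun b hb r hr => liouvilleDensity_le hN hr (hle b hb r hr)
  have hlip : ∀ b, |b - a| ≤ 1 → ∀ r ∈ Icc 0 X,
      |liouvilleDensity N (u b) r - liouvilleDensity N (u a) r| ≤ 2 * K * |u b r - u a r| :=
    fun b hb r hr => abs_liouvilleDensity_sub_le hN hr (hle b hb r hr) (hle a ha r hr)
  have hu : ∀ b, |b - a| ≤ 1 → ∀ r ∈ Icc 0 X,
      |u b r - u a r| ≤ B * |b - a| ∧ |p b r - p a r| ≤ B * |b - a| := by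
    intro b hb r hr
    have := ((F.sol b).sub (F.sol a)).abs_le_exp (L := 2 * K) (e := 0) (X := X) (by positivity)
      le_rfl (fun r hr => by simpa using hlip b hb r (Ioo_subset_Icc_self hr)) hr
    simpa only [F.sol_zero, add_zero, mul_comm |b - a|] using this
  have hφ : ∀ b, |b - a| ≤ 1 → ∀ r ∈ Icc 0 X, |φ b r| ≤ B ∧ |s b r| ≤ B := by
    intro b hb r hr
    have := (F.lin b).abs_le_exp (L := 2 * K) (e := 0) (X := X) (by positivity) le_rfl
      (fun r hr => by
        rw [abs_mul, abs_of_pos (by linarith [liouvilleDensity_pos N (u b) r]), add_zero]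
        gcongr
        exact hdens b hb r (Ioo_subset_Icc_self hr)) hr
    simpa [F.lin_zero] using this
  have hφd : ∀ b, |b - a| ≤ 1 → ∀ r ∈ Icc 0 X,
      |φ b r - φ a r| ≤ 4 * K * B ^ 3 * |b - a| ∧ |s b r - s a r| ≤ 4 * K * B ^ 3 * |b - a| := by
    intro b hb r hr
    have := ((F.lin b).sub (F.lin a)).abs_le_exp (L := 2 * K)
      (e := 4 * K * B ^ 2 * |b - a|) (X := X)
      (by positivity) (by positivity) (fun r hr => by
        have hr' := Ioo_subset_Icc_self hr
        have h1 : 2 * liouvilleDensity N (u b) r * φ b r - 2 * liouvilleDensity N (u a) r * φ a r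
          = 2 * liouvilleDensity N (u b) r * (φ b r - φ a r) +
            2 * (liouvilleDensity N (u b) r - liouvilleDensity N (u a) r) * φ a r := by ring
        rw [h1]
        refine (abs_add_le _ _).trans (add_le_add ?_ ?_)
        · rw [abs_mul, abs_of_pos (by linarith [liouvilleDensity_pos N (u b) r])]
          gcongr
          exact hdens b hb r hr'
        · rw [abs_mul, abs_mul, abs_two]
          calc _ ≤ 2 * (2 * K * (B * |b - a|)) * B := by
                gcongr
                · exact (hlip b hb r hr').trans (by gcongr; exact (hu b hb r hr').1)
                · exact (hφ a ha r hr').1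
            _ = _ := by ring) hr
    simp only [F.lin_zero, sub_self, abs_zero, zero_add] at this
    constructor
    · calc _ ≤ _ := this.1
        _ = _ := by rw [← hB]; ring
    · calc _ ≤ _ := this.2
        _ = _ := by rw [← hB]; ring
  have hKB : 0 ≤ 2 * K * B := by positivity
  have hKB3 : 0 ≤ 4 * K * B ^ 3 := by positivity
  refine ⟨K + B + 2 * K * B + 4 * K * B ^ 3, by positivity, fun b hb r hr => ?_⟩
  have hb0 := abs_nonneg (b - a)
  have hB0 : 0 ≤ B := by linarith
  refine ⟨(hdens b hb r hr).trans (by linarith), (hu b hb r hr).1.trans ?_,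
    (hu b hb r hr).2.trans ?_, (hlip b hb r hr).trans ?_, (hφ b hb r hr).1.trans (by linarith),
    (hφ b hb r hr).2.trans (by linarith), (hφd b hb r hr).1.trans ?_,
    (hφd b hb r hr).2.trans ?_⟩
  · gcongr; linarith
  · gcongr; linarith
  · calc 2 * K * |u b r - u a r| ≤ 2 * K * (B * |b - a|) := by
          gcongr; exact (hu b hb r hr).1
      _ = 2 * K * B * |b - a| := by ring
      _ ≤ _ := by gcongr; linarith
  · gcongr; linarith
  · gcongr; linarith

lemma abs_exp_mul_sub_le {x d : ℝ} (hd : |2 * d| ≤ 1) :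
    |Real.exp (2 * (x + d)) - Real.exp (2 * x) - 2 * Real.exp (2 * x) * d| ≤
      4 * Real.exp (2 * x) * d ^ 2 := by
  have h := Real.abs_exp_sub_one_sub_id_le hd
  have h1 : Real.exp (2 * (x + d)) - Real.exp (2 * x) - 2 * Real.exp (2 * x) * d =
      Real.exp (2 * x) * (Real.exp (2 * d) - 1 - 2 * d) := by
    rw [mul_add, Real.exp_add]; ring
  rw [h1, abs_mul, abs_of_pos (Real.exp_pos _)]
  nlinarith [mul_le_mul_of_nonneg_left h (Real.exp_pos (2 * x)).le]

/-- The Taylor remainder of the density is quadratic in the increment of the solution. -/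
lemma abs_density_taylor_le {v w : ℝ → ℝ} {r : ℝ} (hd : |2 * (v r - w r)| ≤ 1) :
    |liouvilleDensity N v r - liouvilleDensity N w r
        - 2 * liouvilleDensity N w r * (v r - w r)| ≤
      4 * liouvilleDensity N w r * (v r - w r) ^ 2 := by
  have h := abs_exp_mul_sub_le (x := w r) hd
  have h0 : 0 ≤ (1 + r ^ 2) ^ N := by positivity
  have h1 := mul_le_mul_of_nonneg_left h h0
  rw [add_sub_cancel] at h1
  unfold liouvilleDensity
  have h2 : (1 + r ^ 2) ^ N * Real.exp (2 * v r) - (1 + r ^ 2) ^ N * Real.exp (2 * w r)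
      - 2 * ((1 + r ^ 2) ^ N * Real.exp (2 * w r)) * (v r - w r) =
      (1 + r ^ 2) ^ N * (Real.exp (2 * v r) - Real.exp (2 * w r)
        - 2 * Real.exp (2 * w r) * (v r - w r)) := by ring
  rw [h2, abs_mul, abs_of_nonneg h0]
  exact h1.trans_eq (by ring)

/-- `φ_a` is the derivative of `u_a` with respect to `a`, with a quadratic remainder. -/
lemma exists_taylor_bound (F : LiouvilleFamily N u p φ s) (hN : 0 ≤ N) (a X : ℝ) (hX : 0 ≤ X) :
    ∃ C ρ, 0 < C ∧ 0 < ρ ∧ ∀ b, |b - a| ≤ ρ → ∀ r ∈ Icc 0 X,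
      |u b r - u a r - (b - a) * φ a r| ≤ C * |b - a| ^ 2 ∧
      |liouvilleDensity N (u b) r - liouvilleDensity N (u a) r
        - (b - a) * (2 * liouvilleDensity N (u a) r * φ a r)| ≤ C * |b - a| ^ 2 := by
  obtain ⟨C, hC, H⟩ := F.exists_bounds hN a X hX
  set B := Real.exp ((2 + 2 * C) * X) with hB
  have key : ∀ b, |b - a| ≤ min 1 (1 / (2 * C)) → ∀ r ∈ Icc 0 X,
      |u b r - u a r - (b - a) * φ a r| ≤ 4 * C ^ 3 * B * |b - a| ^ 2 ∧
      |liouvilleDensity N (u b) r - liouvilleDensity N (u a) r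
        - 2 * liouvilleDensity N (u a) r * (u b r - u a r)| ≤ 4 * C ^ 3 * |b - a| ^ 2 := by
    intro b hb
    have hb1 := hb.trans (min_le_left _ _)
    have hb2 := hb.trans (min_le_right _ _)
    have htay : ∀ r ∈ Icc 0 X, |liouvilleDensity N (u b) r - liouvilleDensity N (u a) r
        - 2 * liouvilleDensity N (u a) r * (u b r - u a r)| ≤ 4 * C ^ 3 * |b - a| ^ 2 := by
      intro r hr
      have h1 := (H b hb1 r hr).2.1
      have h2 := (H a (by simp) r hr).1
      have h3 : |2 * (u b r - u a r)| ≤ 1 := by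
        rw [abs_mul, abs_two]
        rw [le_div_iff₀ (by positivity)] at hb2
        linarith
      calc _ ≤ _ := abs_density_taylor_le h3
        _ = 4 * liouvilleDensity N (u a) r * |u b r - u a r| ^ 2 := by rw [sq_abs]
        _ ≤ 4 * C * (C * |b - a|) ^ 2 := by gcongr
        _ = _ := by ring
    refine fun r hr => ⟨?_, htay r hr⟩
    have := (((F.sol b).sub (F.sol a)).sub ((F.lin a).const_mul (b - a))).abs_le_exp
      (L := 2 * C) (e := 4 * C ^ 3 * |b - a| ^ 2) (X := X) (by positivity) (by positivity)
      (fun r hr => by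
        have hr' := Ioo_subset_Icc_self hr
        have h1 : liouvilleDensity N (u b) r - liouvilleDensity N (u a) r
            - (b - a) * (2 * liouvilleDensity N (u a) r * φ a r) =
          2 * liouvilleDensity N (u a) r * (u b r - u a r - (b - a) * φ a r) +
          (liouvilleDensity N (u b) r - liouvilleDensity N (u a) r
            - 2 * liouvilleDensity N (u a) r * (u b r - u a r)) := by ring
        rw [h1]
        refine (abs_add_le _ _).trans (add_le_add ?_ (htay r hr'))
        rw [abs_mul, abs_of_pos (by linarith [liouvilleDensity_pos N (u a) r])]
        gcongr
        exact (H a (by simp) r hr').1) hr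
    simp only [F.lin_zero, F.sol_zero, mul_one, sub_self, abs_zero, zero_add] at this
    calc _ ≤ _ := this.1
      _ = _ := by rw [← hB]; ring
  refine ⟨4 * C ^ 3 * B + (2 * C * (4 * C ^ 3 * B) + 4 * C ^ 3), min 1 (1 / (2 * C)),
    by positivity, by positivity, fun b hb r hr => ?_⟩
  obtain ⟨h1, h2⟩ := key b hb r hr
  have hB0 : 0 < B := Real.exp_pos _
  constructor
  · refine h1.trans ?_
    gcongr
    have : 0 ≤ 2 * C * (4 * C ^ 3 * B) + 4 * C ^ 3 := by positivity
    linarith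
  · have h3 : liouvilleDensity N (u b) r - liouvilleDensity N (u a) r
            - (b - a) * (2 * liouvilleDensity N (u a) r * φ a r) =
          2 * liouvilleDensity N (u a) r * (u b r - u a r - (b - a) * φ a r) +
          (liouvilleDensity N (u b) r - liouvilleDensity N (u a) r
            - 2 * liouvilleDensity N (u a) r * (u b r - u a r)) := by ring
    have h4 := (H a (by simp) r hr).1
    have h5 := liouvilleDensity_pos N (u a) r
    rw [h3]
    calc _ ≤ _ := abs_add_le _ _
      _ ≤ 2 * C * (4 * C ^ 3 * B * |b - a| ^ 2) + 4 * C ^ 3 * |b - a| ^ 2 := by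
        refine add_le_add ?_ h2
        rw [abs_mul, abs_of_pos (by linarith)]
        gcongr
      _ = (2 * C * (4 * C ^ 3 * B) + 4 * C ^ 3) * |b - a| ^ 2 := by ring
      _ ≤ _ := by
        refine mul_le_mul_of_nonneg_right ?_ (sq_nonneg _)
        have : 0 ≤ 4 * C ^ 3 * B := by positivity
        linarith

end LiouvilleFamily

lemma RadialODE.eq_zero_of_double_zero {w p k : ℝ → ℝ}
    (H : RadialODE w p (fun r => k r * w r)) {r₀ C : ℝ} (hr₀ : 0 < r₀)
    (hk : ∀ r ∈ Ioo 0 r₀, 0 ≤ k r ∧ k r ≤ C) (hw : w r₀ = 0) (hp : p r₀ = 0) : w 0 = 0 := by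
  have hsub : Icc 0 r₀ ⊆ Ici (0 : ℝ) := fun x hx => hx.1
  have hmono : MonotoneOn (fun r => r ^ 2 * (w r ^ 2 + p r ^ 2) * Real.exp ((1 + C) * r))
      (Icc 0 r₀) := by
    refine monotoneOn_of_hasDerivWithinAt_nonneg (convex_Icc 0 r₀)
      (f' := fun r => (2 * r * w r ^ 2 + r ^ 2 * (2 * w r * p r * (1 - k r)
        + (1 + C) * (w r ^ 2 + p r ^ 2))) * Real.exp ((1 + C) * r)) ?_ ?_ ?_
    · exact ((continuousOn_id.pow 2).mul (((H.cont.mono hsub).pow 2).add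
        ((H.cont_deriv.mono hsub).pow 2))).mul (by fun_prop)
    · intro x hx
      rw [interior_Icc] at hx
      have hx0 : x ≠ 0 := hx.1.ne'
      have h1 := (((H.hasDerivAt x hx.1).pow 2).add ((H.hasDerivAt_deriv x hx.1).pow 2))
      have h2 := ((hasDerivAt_id x).const_mul (1 + C)).exp
      refine ((((hasDerivAt_id x).pow 2).mul h1).mul h2).hasDerivWithinAt.congr_deriv ?_
      simp
      field_simp
      ring
    · intro x hx
      rw [interior_Icc] at hx
      obtain ⟨hk0, hkC⟩ := hk x hx
      refine mul_nonneg ?_ (Real.exp_pos _).le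
      have hx1 := hx.1
      have h1 : 0 ≤ 2 * w x * p x * (1 - k x) + (1 + C) * (w x ^ 2 + p x ^ 2) := by
        have : |2 * w x * p x| ≤ w x ^ 2 + p x ^ 2 := by
          rw [abs_le]; constructor <;> nlinarith [sq_nonneg (w x - p x), sq_nonneg (w x + p x)]
        have h2 : |1 - k x| ≤ 1 + C := by rw [abs_le]; constructor <;> linarith
        have h3 : |2 * w x * p x * (1 - k x)| ≤ (w x ^ 2 + p x ^ 2) * (1 + C) := by
          rw [abs_mul]; gcongr
        linarith [(abs_le.1 h3).1]
      positivity
  have hzero : ∀ r ∈ Ioo 0 r₀, w r = 0 := by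
    intro r hr
    have h1 := hmono (Ioo_subset_Icc_self hr) (right_mem_Icc.2 hr₀.le) hr.2.le
    simp only [hw, hp] at h1
    have h2 : 0 < r ^ 2 * Real.exp ((1 + C) * r) := by have := hr.1; positivity
    have h3 : w r ^ 2 + p r ^ 2 ≤ 0 := by
      by_contra hc
      nlinarith [mul_pos h2 (not_le.1 hc)]
    exact pow_eq_zero_iff (two_ne_zero) |>.1 (by nlinarith [sq_nonneg (w r), sq_nonneg (p r)])
  have ht : Tendsto w (nhdsWithin 0 (Ioi 0)) (nhds (w 0)) :=
    (H.cont 0 (mem_Ici.2 le_rfl)).mono_left (nhdsWithin_mono _ Ioi_subset_Ici_self)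
  refine tendsto_nhds_unique ht (tendsto_const_nhds.congr' ?_)
  filter_upwards [Ioo_mem_nhdsGT hr₀] with r hr using (hzero r hr).symm

/-- Beyond a radius where the potential is small, two zeros force a double zero. -/
lemma RadialODE.deriv_eq_zero_of_two_zeros {w p k : ℝ → ℝ}
    (H : RadialODE w p (fun r => k r * w r)) {δ R₀ : ℝ} (hR₀ : 1 ≤ R₀) (hδ : 0 < δ)
    (hk : ∀ r, R₀ ≤ r → k r * r ^ 2 ≤ δ ^ 2 / 4 * r ^ (-δ)) {r₀ r₁ : ℝ} (h₀ : R₀ ≤ r₀)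
    (h₁ : r₀ < r₁) (hw₀ : w r₀ = 0) (hw₁ : w r₁ = 0) : p r₀ = 0 := by
  have hsub : Icc r₀ r₁ ⊆ Ici (0 : ℝ) := fun x hx => mem_Ici.2 (by linarith [hx.1])
  set G : ℝ → ℝ := fun r => r * w r * p r - w r ^ 2 * (δ / 2 * r ^ (-δ)) with hG
  set G' : ℝ → ℝ := fun r => r * p r ^ 2 - r * k r * w r ^ 2 - δ * r ^ (-δ) * w r * p r
    + δ ^ 2 / 2 * (r ^ (-δ) / r) * w r ^ 2 with hG'
  have hder : ∀ x ∈ Ioo r₀ r₁, HasDerivAt G (G' x) x := by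
    intro x hx
    have hx0 : 0 < x := by linarith [hx.1]
    have h1 := ((hasDerivAt_id x).mul (H.hasDerivAt x hx0)).mul (H.hasDerivAt_deriv x hx0)
    have h2 := ((H.hasDerivAt x hx0).pow 2).mul
      ((Real.hasDerivAt_rpow_const (p := -δ) (Or.inl hx0.ne')).const_mul (δ / 2))
    refine (h1.sub h2).congr_deriv ?_
    simp only [hG', Real.rpow_sub_one hx0.ne']
    simp
    field_simp
    ring
  have hlow : ∀ x ∈ Ioo r₀ r₁, (x * p x - δ / 2 * x ^ (-δ) * w x) ^ 2 ≤ x * G' x := by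
    intro x hx
    have hx0 : 0 < x := by linarith [hx.1]
    have hy1 : x ^ (-δ) ≤ 1 := Real.rpow_le_one_of_one_le_of_nonpos (by linarith [hx.1])
      (by linarith)
    have hy0 : 0 < x ^ (-δ) := Real.rpow_pos_of_pos hx0 _
    have hkx := hk x (by linarith [hx.1])
    have h1 : x * G' x = (x * p x) ^ 2 - k x * x ^ 2 * w x ^ 2 - δ * x ^ (-δ) * w x * (x * p x)
        + δ ^ 2 / 2 * x ^ (-δ) * w x ^ 2 := by
      simp only [hG']; field_simp
    have h2 : (x ^ (-δ)) ^ 2 ≤ x ^ (-δ) := by nlinarith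
    have h3 : k x * x ^ 2 + (δ / 2 * x ^ (-δ)) ^ 2 ≤ δ ^ 2 / 2 * x ^ (-δ) := by
      nlinarith [mul_le_mul_of_nonneg_left h2 (sq_nonneg δ)]
    rw [h1]
    nlinarith [mul_le_mul_of_nonneg_right h3 (sq_nonneg (w x))]
  have hmono : MonotoneOn G (Icc r₀ r₁) := by
    refine monotoneOn_of_hasDerivWithinAt_nonneg (convex_Icc r₀ r₁) (f' := G') ?_ ?_ ?_
    · refine ((continuousOn_id.mul (H.cont.mono hsub)).mul (H.cont_deriv.mono hsub)).sub
        (((H.cont.mono hsub).pow 2).mul (continuousOn_const.mul ?_))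
      exact continuousOn_id.rpow_const fun x hx => Or.inl (by
        have := hx.1
        simp only [id]
        linarith)
    · intro x hx
      rw [interior_Icc] at hx
      exact (hder x hx).hasDerivWithinAt
    · intro x hx
      rw [interior_Icc] at hx
      have hx0 : 0 < x := by linarith [hx.1]
      by_contra hc
      nlinarith [hlow x hx, mul_pos hx0 (neg_pos.2 (not_le.1 hc)),
        sq_nonneg (x * p x - δ / 2 * x ^ (-δ) * w x)]
  have hGz : ∀ x ∈ Ioo r₀ r₁, G x = 0 := by
    intro x hx
    have hx' := Ioo_subset_Icc_self hx
    have h1 := hmono (left_mem_Icc.2 h₁.le) hx' hx.1.le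
    have h2 := hmono hx' (right_mem_Icc.2 h₁.le) hx.2.le
    have h3 : G r₀ = 0 := by simp [hG, hw₀]
    have h4 : G r₁ = 0 := by simp [hG, hw₁]
    linarith
  have hp : ∀ x ∈ Ioo r₀ r₁, x * p x = δ / 2 * x ^ (-δ) * w x := by
    intro x hx
    have hev : G =ᶠ[nhds x] fun _ => 0 := by
      filter_upwards [Ioo_mem_nhds hx.1 hx.2] with y hy using hGz y hy
    have h1 : G' x = 0 := (hder x hx).unique ((hasDerivAt_const x (0 : ℝ)).congr_of_eventuallyEq hev)
    have h2 := hlow x hx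
    rw [h1, mul_zero] at h2
    have := pow_eq_zero_iff two_ne_zero |>.1 (le_antisymm h2 (sq_nonneg _))
    linarith
  have hr₀ : 0 < r₀ := by linarith
  have hcont : ∀ f : ℝ → ℝ, ContinuousAt f r₀ →
      Tendsto f (nhdsWithin r₀ (Ioi r₀)) (nhds (f r₀)) := fun f hf => hf.mono_left inf_le_left
  have hl : Tendsto (fun x => x * p x) (nhdsWithin r₀ (Ioi r₀)) (nhds (r₀ * p r₀)) :=
    hcont (fun x => x * p x) (continuousAt_id.mul (H.hasDerivAt_deriv r₀ hr₀).continuousAt)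
  have hr : Tendsto (fun x => δ / 2 * x ^ (-δ) * w x) (nhdsWithin r₀ (Ioi r₀))
      (nhds (δ / 2 * r₀ ^ (-δ) * w r₀)) :=
    hcont (fun x => δ / 2 * x ^ (-δ) * w x) ((continuousAt_const.mul
      (Real.continuousAt_rpow_const _ _ (Or.inl hr₀.ne'))).mul
        (H.hasDerivAt r₀ hr₀).continuousAt)
  have heq := tendsto_nhds_unique hl (hr.congr' (by
    filter_upwards [Ioo_mem_nhdsGT h₁] with x hx using (hp x hx).symm))
  rw [hw₀, mul_zero] at heq
  exact (mul_eq_zero.1 heq).resolve_left hr₀.ne'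

lemma RadialODE.sq_le_mul_rpow {w p k : ℝ → ℝ}
    (H : RadialODE w p (fun r => k r * w r)) {δ R₀ : ℝ} (hR₀ : 1 ≤ R₀) (hδ : 0 < δ)
    (hk : ∀ r, R₀ ≤ r → 0 ≤ k r ∧ k r * r ^ 2 ≤ δ ^ 2 / 4 * r ^ (-δ)) {r : ℝ} (hr : R₀ ≤ r) :
    w r ^ 2 ≤ (w R₀ ^ 2 + 4 / δ ^ 2 * (R₀ * p R₀) ^ 2) * r ^ (δ / 2) := by
  have hsub : Ici R₀ ⊆ Ici (0 : ℝ) := Ici_subset_Ici.2 (by linarith)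
  have hanti : AntitoneOn (fun r => (δ ^ 2 / 4 * w r ^ 2 + (r * p r) ^ 2) * r ^ (-(δ / 2)))
      (Ici R₀) := by
    refine antitoneOn_of_hasDerivWithinAt_nonpos (convex_Ici R₀)
      (f' := fun r => (2 * (δ ^ 2 / 4 - k r * r ^ 2) * w r * (r * p r)
        - δ / 2 * (δ ^ 2 / 4 * w r ^ 2 + (r * p r) ^ 2)) * (r ^ (-(δ / 2)) / r)) ?_ ?_ ?_
    · refine ((continuousOn_const.mul ((H.cont.mono hsub).pow 2)).add
        ((continuousOn_id.mul (H.cont_deriv.mono hsub)).pow 2)).mul ?_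
      exact continuousOn_id.rpow_const fun x hx => Or.inl (by
        have := mem_Ici.1 hx
        simp only [id]
        linarith)
    · intro x hx
      rw [interior_Ici] at hx
      have hx0 : 0 < x := by linarith [mem_Ioi.1 hx]
      have h1 := (((H.hasDerivAt x hx0).pow 2).const_mul (δ ^ 2 / 4)).add
        (((hasDerivAt_id x).mul (H.hasDerivAt_deriv x hx0)).pow 2)
      refine (h1.mul (Real.hasDerivAt_rpow_const (p := -(δ / 2))
        (Or.inl hx0.ne'))).hasDerivWithinAt.congr_deriv ?_
      simp only [Real.rpow_sub_one hx0.ne']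
      simp
      field_simp
      ring
    · intro x hx
      rw [interior_Ici] at hx
      have hx1 : 1 < x := by linarith [mem_Ioi.1 hx]
      have hx0 : 0 < x := by linarith
      have hy0 : 0 < x ^ (-(δ / 2)) := Real.rpow_pos_of_pos hx0 _
      have hy1 : x ^ (-δ) ≤ 1 := Real.rpow_le_one_of_one_le_of_nonpos hx1.le (by linarith)
      obtain ⟨hk0, hk1⟩ := hk x (le_of_lt hx)
      refine mul_nonpos_of_nonpos_of_nonneg ?_ (by positivity)
      set c := δ ^ 2 / 4 - k x * x ^ 2 with hc
      have hkx : 0 ≤ k x * x ^ 2 := by positivity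
      have hc1 : |c| ≤ δ ^ 2 / 4 := by
        rw [abs_le]; constructor <;> nlinarith [sq_nonneg δ]
      have h1 : |w x * (x * p x)| * δ ≤ δ ^ 2 / 4 * w x ^ 2 + (x * p x) ^ 2 := by
        rw [abs_mul]
        nlinarith [sq_nonneg (δ / 2 * |w x| - |x * p x|), sq_abs (w x), sq_abs (x * p x)]
      have h2 : c * (w x * (x * p x)) ≤ δ ^ 2 / 4 * |w x * (x * p x)| := by
        calc _ ≤ |c * (w x * (x * p x))| := le_abs_self _
          _ ≤ _ := by rw [abs_mul]; gcongr
      nlinarith [mul_le_mul_of_nonneg_left h1 hδ.le]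
  have h1 := hanti (mem_Ici.2 le_rfl) (mem_Ici.2 hr) hr
  have hr0 : 0 < r := by linarith
  have h2 : R₀ ^ (-(δ / 2)) ≤ 1 :=
    Real.rpow_le_one_of_one_le_of_nonpos hR₀ (by linarith)
  set E := δ ^ 2 / 4 * w R₀ ^ 2 + (R₀ * p R₀) ^ 2 with hE
  have hE0 : 0 ≤ E := by positivity
  have h3 : (δ ^ 2 / 4 * w r ^ 2 + (r * p r) ^ 2) * r ^ (-(δ / 2)) ≤ E := by
    simp only at h1
    nlinarith
  have hy : 0 < r ^ (δ / 2) := Real.rpow_pos_of_pos hr0 _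
  rw [Real.rpow_neg hr0.le, ← div_eq_mul_inv, div_le_iff₀ hy] at h3
  have h4 : w R₀ ^ 2 + 4 / δ ^ 2 * (R₀ * p R₀) ^ 2 = 4 / δ ^ 2 * E := by
    rw [hE]; field_simp
  have h5 : w r ^ 2 = 4 / δ ^ 2 * (δ ^ 2 / 4 * w r ^ 2) := by field_simp
  rw [h4, h5, mul_assoc]
  exact mul_le_mul_of_nonneg_left (by linarith [sq_nonneg (r * p r)]) (by positivity)

/-- Finite mass forces `r u'(r)` to drop strictly below `-(N + 1)`. -/
lemma RadialODE.exists_mul_deriv_lt {N : ℝ} (hN : 0 ≤ N) {u p : ℝ → ℝ}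
    (H : RadialODE u p (liouvilleDensity N u))
    (hint : IntegrableOn (fun r => liouvilleDensity N u r * r) (Ioi 0)) :
    ∃ r, 1 ≤ r ∧ r * p r < -(N + 1) := by
  by_contra! hc
  have hmono : MonotoneOn (fun r => u r + (N + 1) * Real.log r) (Ici 1) := by
    refine monotoneOn_of_hasDerivWithinAt_nonneg (convex_Ici 1)
      (f' := fun r => p r + (N + 1) * r⁻¹) ?_ ?_ ?_
    · refine (H.cont.mono (Ici_subset_Ici.2 zero_le_one)).add (continuousOn_const.mul ?_)
      exact Real.continuousOn_log.mono fun x hx => by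
        have := mem_Ici.1 hx
        simp only [mem_compl_iff, mem_singleton_iff]
        linarith
    · intro x hx
      rw [interior_Ici] at hx
      have hx0 : 0 < x := zero_lt_one.trans hx
      exact ((H.hasDerivAt x hx0).add
        ((Real.hasDerivAt_log hx0.ne').const_mul (N + 1))).hasDerivWithinAt
    · intro x hx
      rw [interior_Ici] at hx
      have hx0 : 0 < x := zero_lt_one.trans hx
      have h1 := hc x (le_of_lt hx)
      have h2 : p x + (N + 1) * x⁻¹ = (x * p x + (N + 1)) / x := by field_simp
      rw [h2]
      exact div_nonneg (by linarith) hx0.le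
  have hbound : ∀ r ∈ Ioi (1 : ℝ), Real.exp (2 * u 1) * r⁻¹ ≤ liouvilleDensity N u r * r := by
    intro r hr
    have hr0 : 0 < r := zero_lt_one.trans hr
    have h1 := hmono (mem_Ici.2 le_rfl) (mem_Ici.2 (le_of_lt hr)) (le_of_lt hr)
    simp only [Real.log_one, mul_zero, add_zero] at h1
    have h2 : Real.exp (2 * u 1) * r ^ (-(2 * (N + 1))) ≤ Real.exp (2 * u r) := by
      rw [Real.rpow_def_of_pos hr0, ← Real.exp_add]
      exact Real.exp_le_exp.2 (by nlinarith)
    have h3 : r ^ (2 * N) ≤ (1 + r ^ 2) ^ N := by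
      rw [Real.rpow_mul hr0.le, Real.rpow_two]
      gcongr
      linarith
    have h4 : r ^ (2 * N) * r ^ (-(2 * (N + 1))) * r = r⁻¹ := by
      rw [← Real.rpow_add hr0, ← Real.rpow_add_one hr0.ne', ← Real.rpow_neg_one]
      congr 1; ring
    unfold liouvilleDensity
    calc _ = r ^ (2 * N) * (Real.exp (2 * u 1) * r ^ (-(2 * (N + 1)))) * r := by
          rw [← h4]; ring
      _ ≤ _ := by gcongr
  have hint1 : IntegrableOn (fun r : ℝ => Real.exp (2 * u 1) * r⁻¹) (Ioi 1) := by
    refine Integrable.mono' (hint.mono_set (Ioi_subset_Ioi zero_le_one))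
      (by fun_prop) ?_
    refine (ae_restrict_iff' measurableSet_Ioi).2 (ae_of_all _ fun r hr => ?_)
    have hr0 : 0 < r := zero_lt_one.trans hr
    rw [Real.norm_of_nonneg (by positivity)]
    exact hbound r hr
  refine not_integrableOn_Ioi_inv (a := 1) ?_
  have := hint1.const_mul (Real.exp (2 * u 1))⁻¹
  refine this.congr (ae_of_all _ fun r => ?_)
  simp only
  rw [inv_mul_cancel_left₀ (Real.exp_pos _).ne']

lemma RadialODE.density_mul_sq_le {N : ℝ} (hN : 0 ≤ N) {u p : ℝ → ℝ}
    (H : RadialODE u p (liouvilleDensity N u)) {r₁ δ M : ℝ} (hr₁ : 1 ≤ r₁)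
    (hp : r₁ * p r₁ ≤ -(N + 1 + δ)) (hM : u r₁ ≤ M) {r : ℝ} (hr : r₁ ≤ r) :
    liouvilleDensity N u r * r ^ 2 ≤
      2 ^ N * Real.exp (2 * M) * r₁ ^ (2 * (N + 1 + δ)) * r ^ (-(2 * δ)) := by
  have hanti : AntitoneOn (fun r => u r + (N + 1 + δ) * Real.log r) (Ici r₁) := by
    refine antitoneOn_of_hasDerivWithinAt_nonpos (convex_Ici r₁)
      (f' := fun r => p r + (N + 1 + δ) * r⁻¹) ?_ ?_ ?_
    · refine (H.cont.mono (Ici_subset_Ici.2 (by linarith))).add (continuousOn_const.mul ?_)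
      exact Real.continuousOn_log.mono fun x hx => by
        have := mem_Ici.1 hx
        simp only [mem_compl_iff, mem_singleton_iff]
        linarith
    · intro x hx
      rw [interior_Ici] at hx
      have hx0 : 0 < x := by linarith [mem_Ioi.1 hx]
      exact ((H.hasDerivAt x hx0).add
        ((Real.hasDerivAt_log hx0.ne').const_mul (N + 1 + δ))).hasDerivWithinAt
    · intro x hx
      rw [interior_Ici] at hx
      have hx0 : 0 < x := by linarith [mem_Ioi.1 hx]
      have h1 := H.antitoneOn_mul (fun r _ => (liouvilleDensity_pos N u r).le)
        (mem_Ici.2 (by linarith : (0 : ℝ) ≤ r₁)) (mem_Ici.2 hx0.le) (le_of_lt hx)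
      simp only at h1
      have h2 : p x + (N + 1 + δ) * x⁻¹ = (x * p x + (N + 1 + δ)) / x := by field_simp
      rw [h2]
      exact div_nonpos_of_nonpos_of_nonneg (by linarith) hx0.le
  have hr0 : 0 < r := by linarith
  have hr₁0 : 0 < r₁ := by linarith
  have h1 := hanti (mem_Ici.2 le_rfl) (mem_Ici.2 hr) hr
  simp only at h1
  have h2 : Real.exp (2 * u r) ≤
      Real.exp (2 * M) * r₁ ^ (2 * (N + 1 + δ)) * r ^ (-(2 * (N + 1 + δ))) := by
    rw [Real.rpow_def_of_pos hr0, Real.rpow_def_of_pos hr₁0, ← Real.exp_add, ← Real.exp_add]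
    exact Real.exp_le_exp.2 (by nlinarith)
  have h3 : (1 + r ^ 2) ^ N ≤ 2 ^ N * r ^ (2 * N) := by
    rw [Real.rpow_mul hr0.le, Real.rpow_two, ← Real.mul_rpow zero_le_two (sq_nonneg r)]
    gcongr
    nlinarith
  have h4 : r ^ (2 * N) * r ^ (-(2 * (N + 1 + δ))) * r ^ 2 = r ^ (-(2 * δ)) := by
    rw [← Real.rpow_two, ← Real.rpow_add hr0, ← Real.rpow_add hr0]
    congr 1; ring
  unfold liouvilleDensity
  calc _ ≤ 2 ^ N * r ^ (2 * N) *
        (Real.exp (2 * M) * r₁ ^ (2 * (N + 1 + δ)) * r ^ (-(2 * (N + 1 + δ)))) * r ^ 2 := by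
        gcongr
    _ = 2 ^ N * Real.exp (2 * M) * r₁ ^ (2 * (N + 1 + δ)) *
        (r ^ (2 * N) * r ^ (-(2 * (N + 1 + δ))) * r ^ 2) := by ring
    _ = _ := by rw [h4]

namespace LiouvilleFamily

variable {N : ℝ} {u p φ s : ℝ → ℝ → ℝ}

lemma tendsto_apply (F : LiouvilleFamily N u p φ s) (hN : 0 ≤ N) (a : ℝ) {r : ℝ} (hr : 0 ≤ r) :
    Tendsto (fun b => liouvilleDensity N (u b) r) (nhds a) (nhds (liouvilleDensity N (u a) r)) ∧
      Tendsto (fun b => φ b r) (nhds a) (nhds (φ a r)) := by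
  obtain ⟨C, -, H⟩ := F.exists_bounds hN a r hr
  have hz : Tendsto (fun b => C * |b - a|) (nhds a) (nhds 0) := by
    have : Continuous fun b => C * |b - a| := by fun_prop
    simpa using this.tendsto a
  have hev : ∀ᶠ b in nhds a, |b - a| ≤ 1 := by
    filter_upwards [Metric.closedBall_mem_nhds a one_pos] with b hb
    rwa [Metric.mem_closedBall, Real.dist_eq] at hb
  have hr' : r ∈ Icc 0 r := right_mem_Icc.2 hr
  constructor
  · rw [tendsto_iff_dist_tendsto_zero]
    refine squeeze_zero' (Eventually.of_forall fun _ => dist_nonneg) ?_ hz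
    filter_upwards [hev] with b hb using (H b hb r hr').2.2.2.1
  · rw [tendsto_iff_dist_tendsto_zero]
    refine squeeze_zero' (Eventually.of_forall fun _ => dist_nonneg) ?_ hz
    filter_upwards [hev] with b hb using (H b hb r hr').2.2.2.2.2.2.1

/-- Uniform decay of the potential at infinity near a given initial value. -/
lemma exists_uniform_decay (F : LiouvilleFamily N u p φ s) (hN : 0 ≤ N) (a : ℝ)
    (hint : IntegrableOn (fun r => liouvilleDensity N (u a) r * r) (Ioi 0)) :
    ∃ δ R₀, 0 < δ ∧ 1 ≤ R₀ ∧ ∀ᶠ b in nhds a, ∀ r, R₀ ≤ r →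
      2 * liouvilleDensity N (u b) r * r ^ 2 ≤ δ ^ 2 / 4 * r ^ (-δ) := by
  obtain ⟨r₁, hr₁, hlt⟩ := (F.sol a).exists_mul_deriv_lt hN hint
  obtain ⟨C, hC, H⟩ := F.exists_bounds hN a r₁ (by linarith)
  set δ := (-(N + 1) - r₁ * p a r₁) / 2 with hδ
  have hδ0 : 0 < δ := by linarith
  set K := 2 * (2 ^ N * Real.exp (2 * (a + 1)) * r₁ ^ (2 * (N + 1 + δ))) with hK
  have hlim : Tendsto (fun r : ℝ => K * r ^ (-δ)) atTop (nhds 0) := by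
    simpa using (tendsto_rpow_neg_atTop hδ0).const_mul K
  obtain ⟨R₁, hR₁⟩ := eventually_atTop.1
    (hlim.eventually (ge_mem_nhds (show (0 : ℝ) < δ ^ 2 / 4 by positivity)))
  refine ⟨δ, max r₁ R₁, hδ0, hr₁.trans (le_max_left _ _), ?_⟩
  have hρ : 0 < min 1 (δ / (C * r₁)) := by positivity
  filter_upwards [Metric.closedBall_mem_nhds a hρ] with b hb r hr
  rw [Metric.mem_closedBall, Real.dist_eq] at hb
  have hb1 := hb.trans (min_le_left _ _)
  have hb2 := hb.trans (min_le_right _ _)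
  rw [le_div_iff₀ (by positivity)] at hb2
  have hr0 : 0 < r := by linarith [(le_max_left _ _).trans hr]
  have h1 := (H b hb1 r₁ ⟨by linarith, le_rfl⟩).2.2.1
  have h2 : r₁ * p b r₁ ≤ -(N + 1 + δ) := by
    have h3 : r₁ * (p b r₁ - p a r₁) ≤ r₁ * (C * |b - a|) := by
      gcongr; exact (le_abs_self _).trans h1
    linarith
  have h4 : u b r₁ ≤ a + 1 := (F.le_init b (by linarith)).trans (by linarith [(abs_le.1 hb1).2])
  have h5 := (F.sol b).density_mul_sq_le hN hr₁ h2 h4 ((le_max_left _ _).trans hr)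
  have h6 := hR₁ r ((le_max_right _ _).trans hr)
  have h7 : r ^ (-(2 * δ)) = r ^ (-δ) * r ^ (-δ) := by
    rw [← Real.rpow_add hr0]; congr 1; ring
  calc 2 * liouvilleDensity N (u b) r * r ^ 2 = 2 * (liouvilleDensity N (u b) r * r ^ 2) := by ring
    _ ≤ K * r ^ (-δ) * r ^ (-δ) := by
      rw [hK, mul_assoc, ← h7, mul_assoc 2]
      gcongr
    _ ≤ _ := by gcongr

lemma lin_deriv_ne_zero (F : LiouvilleFamily N u p φ s) (hN : 0 ≤ N) (a : ℝ) {r : ℝ}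
    (hr : 0 < r) (hz : φ a r = 0) : s a r ≠ 0 := by
  intro hs
  obtain ⟨C, -, H⟩ := F.exists_bounds hN a r hr.le
  have := (F.lin a).eq_zero_of_double_zero (C := 2 * C) hr (fun x hx =>
    ⟨by linarith [liouvilleDensity_pos N (u a) x],
      by linarith [(H a (by simp) x (Ioo_subset_Icc_self hx)).1]⟩) hz hs
  rw [F.lin_zero] at this
  exact one_ne_zero this

/-- A zero beyond the decay radius is the largest zero. -/
lemma eq_of_isGreatest (F : LiouvilleFamily N u p φ s) (hN : 0 ≤ N) {b δ R₀ R z : ℝ}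
    (hδ : 0 < δ) (hR₀ : 1 ≤ R₀)
    (hdec : ∀ r, R₀ ≤ r → 2 * liouvilleDensity N (u b) r * r ^ 2 ≤ δ ^ 2 / 4 * r ^ (-δ))
    (hR : IsGreatest {r : ℝ | 0 < r ∧ φ b r = 0} R) (hz : R₀ ≤ z) (hφz : φ b z = 0) : z = R := by
  have hz0 : 0 < z := by linarith
  refine (hR.2 ⟨hz0, hφz⟩).eq_of_not_lt fun hlt => ?_
  exact F.lin_deriv_ne_zero hN b hz0 hφz
    ((F.lin b).deriv_eq_zero_of_two_zeros hR₀ hδ hdec hz hlt hφz hR.1.2)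

lemma continuousAt_largest_zero (F : LiouvilleFamily N u p φ s) (hN : 0 ≤ N) {a δ R₀ : ℝ}
    {R : ℝ → ℝ} (hδ : 0 < δ) (hR₀ : 1 ≤ R₀)
    (hdec : ∀ᶠ b in nhds a, ∀ r, R₀ ≤ r →
      2 * liouvilleDensity N (u b) r * r ^ 2 ≤ δ ^ 2 / 4 * r ^ (-δ))
    (hR : ∀ᶠ b in nhds a, IsGreatest {r : ℝ | 0 < r ∧ φ b r = 0} (R b)) (hRa : R₀ < R a) :
    Tendsto R (nhds a) (nhds (R a)) := by
  have hX0 : 0 < R a := by linarith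
  have hX : φ a (R a) = 0 := hR.self_of_nhds.1.2
  set c := s a (R a) with hc
  have hc0 : c ≠ 0 := F.lin_deriv_ne_zero hN a hX0 hX
  have hder := ((F.lin a).hasDerivAt (R a) hX0).const_mul c
  have hslope := (hasDerivAt_iff_tendsto_slope.1 hder).eventually
    (lt_mem_nhds (show 0 < c * s a (R a) from mul_self_pos.2 hc0))
  rw [eventually_nhdsWithin_iff] at hslope
  have key : ∀ l m, l < R a → R a < m → ∀ᶠ b in nhds a, l < R b ∧ R b < m := by
    intro l m hl hm
    have hleft : ∃ x, max l R₀ < x ∧ x < R a ∧ c * φ a x < 0 := by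
      have h1 : ∀ᶠ x in nhdsWithin (R a) (Iio (R a)), x ∈ Ioo (max l R₀) (R a) :=
        Ioo_mem_nhdsLT (max_lt hl hRa)
      obtain ⟨x, hx, hs⟩ := (h1.and (hslope.filter_mono nhdsWithin_le_nhds)).exists
      refine ⟨x, hx.1, hx.2, ?_⟩
      have h2 := hs hx.2.ne
      rw [slope_def_field, hX, mul_zero, sub_zero] at h2
      by_contra hcon
      exact absurd h2 (not_lt.2 (div_nonpos_of_nonneg_of_nonpos (not_lt.1 hcon)
        (by linarith [hx.2])))
    have hright : ∃ y, R a < y ∧ y < m ∧ 0 < c * φ a y := by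
      have h1 : ∀ᶠ x in nhdsWithin (R a) (Ioi (R a)), x ∈ Ioo (R a) m := Ioo_mem_nhdsGT hm
      obtain ⟨x, hx, hs⟩ := (h1.and (hslope.filter_mono nhdsWithin_le_nhds)).exists
      refine ⟨x, hx.1, hx.2, ?_⟩
      have h2 := hs hx.1.ne'
      rw [slope_def_field, hX, mul_zero, sub_zero] at h2
      by_contra hcon
      exact absurd h2 (not_lt.2 (div_nonpos_of_nonpos_of_nonneg (not_lt.1 hcon)
        (by linarith [hx.1])))
    obtain ⟨x, hx1, hx2, hx3⟩ := hleft
    obtain ⟨y, hy1, hy2, hy3⟩ := hright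
    have hx0 : R₀ < x := (le_max_right _ _).trans_lt hx1
    have hx0' : 0 ≤ x := by linarith
    have hy0 : 0 ≤ y := by linarith
    filter_upwards [hdec, hR,
      ((F.tendsto_apply hN a hx0').2.const_mul c).eventually (gt_mem_nhds hx3),
      ((F.tendsto_apply hN a hy0).2.const_mul c).eventually (lt_mem_nhds hy3)]
      with b hb1 hb2 hb3 hb4
    have hcont : ContinuousOn (fun r => c * φ b r) (Icc x y) :=
      continuousOn_const.mul ((F.lin b).cont.mono fun r hr => hx0'.trans hr.1)
    obtain ⟨z, hz, hz0⟩ := intermediate_value_Ioo (by linarith : x ≤ y) hcont ⟨hb3, hb4⟩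
    have hφz : φ b z = 0 := (mul_eq_zero.1 hz0).resolve_left hc0
    have := F.eq_of_isGreatest hN hδ hR₀ hb1 hb2 (by linarith [hz.1]) hφz
    rw [← this]
    exact ⟨((le_max_left _ _).trans_lt hx1).trans hz.1, hz.2.trans hy2⟩
  refine tendsto_order.2 ⟨fun l hl => ?_, fun m hm => ?_⟩
  · exact (key l (R a + 1) hl (by linarith)).mono fun b hb => hb.1
  · exact (key (R a - 1) m (by linarith) hm).mono fun b hb => hb.2

lemma continuousOn_density (F : LiouvilleFamily N u p φ s) (a : ℝ) :
    ContinuousOn (liouvilleDensity N (u a)) (Ici 0) := by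
  have h1 : Continuous fun r : ℝ => (1 + r ^ 2) ^ N :=
    Continuous.rpow_const (by fun_prop) fun r => Or.inl (by positivity)
  exact h1.continuousOn.mul (continuousOn_const.mul (F.sol a).cont).rexp

lemma wronskian_identity (F : LiouvilleFamily N u p φ s) (a b : ℝ) {X : ℝ} (hX : 0 ≤ X) :
    X * (s b X * φ a X - s a X * φ b X) =
      ∫ r in (0 : ℝ)..X, -(2 * (liouvilleDensity N (u b) r - liouvilleDensity N (u a) r)
        * φ a r * φ b r * r) := by
  have hsub : Icc 0 X ⊆ Ici (0 : ℝ) := fun x hx => hx.1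
  have hc := fun b => (F.continuousOn_density b).mono hsub
  have hφ := fun b => (F.lin b).cont.mono hsub
  have hs := fun b => (F.lin b).cont_deriv.mono hsub
  rw [intervalIntegral.integral_eq_sub_of_hasDerivAt_of_le hX
    (f := fun r => r * (s b r * φ a r - s a r * φ b r))]
  · simp
  · exact continuousOn_id.mul (((hs b).mul (hφ a)).sub ((hs a).mul (hφ b)))
  · intro x hx
    have hx0 : x ≠ 0 := hx.1.ne'
    refine ((hasDerivAt_id x).mul
      ((((F.lin b).hasDerivAt_deriv x hx.1).mul ((F.lin a).hasDerivAt x hx.1)).sub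
      (((F.lin a).hasDerivAt_deriv x hx.1).mul ((F.lin b).hasDerivAt x hx.1)))).congr_deriv ?_
    simp
    field_simp
    ring
  · refine ContinuousOn.intervalIntegrable_of_Icc hX ?_
    exact (((((continuousOn_const.mul ((hc b).sub (hc a))).mul (hφ a)).mul (hφ b)).mul
      continuousOn_id)).neg

/-- At a zero of `φ_a`, the difference quotients of `φ` in the parameter converge. -/
lemma tendsto_lin_div (F : LiouvilleFamily N u p φ s) (hN : 0 ≤ N) (a : ℝ) {X : ℝ}
    (hX : 0 < X) (hz : φ a X = 0) :
    Tendsto (fun b => φ b X / (b - a)) (nhdsWithin a {a}ᶜ)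
      (nhds (4 / (X * s a X) *
        ∫ r in (0 : ℝ)..X, liouvilleDensity N (u a) r * φ a r ^ 3 * r)) := by
  have hs := F.lin_deriv_ne_zero hN a hX hz
  have hsub : Set.uIoc 0 X ⊆ Ici (0 : ℝ) := fun x hx => by
    rw [Set.uIoc_of_le hX.le] at hx; exact hx.1.le
  obtain ⟨C, hC, H⟩ := F.exists_bounds hN a X hX.le
  obtain ⟨C', ρ, hC', hρ, H'⟩ := F.exists_taylor_bound hN a X hX.le
  have hne : ∀ᶠ b in nhdsWithin a {a}ᶜ, b ≠ a := eventually_mem_nhdsWithin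
  have hball : ∀ ρ : ℝ, 0 < ρ → ∀ᶠ b in nhdsWithin a {a}ᶜ, |b - a| ≤ ρ := by
    intro ρ hρ
    filter_upwards [nhdsWithin_le_nhds (Metric.closedBall_mem_nhds a hρ)] with b hb
    rwa [Metric.mem_closedBall, Real.dist_eq] at hb
  have hlim : Tendsto (fun b => ∫ r in (0 : ℝ)..X,
      (liouvilleDensity N (u b) r - liouvilleDensity N (u a) r) / (b - a) * φ a r * φ b r * r)
      (nhdsWithin a {a}ᶜ) (nhds (∫ r in (0 : ℝ)..X,
        2 * liouvilleDensity N (u a) r * φ a r * φ a r * φ a r * r)) := by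
    refine intervalIntegral.tendsto_integral_filter_of_dominated_convergence
      (fun _ => C * C * C * X) (Eventually.of_forall fun b => ?_) ?_
      intervalIntegrable_const (ae_of_all _ fun r hr => ?_)
    · refine ContinuousOn.aestronglyMeasurable ?_ measurableSet_uIoc
      exact (((((F.continuousOn_density b).sub (F.continuousOn_density a)).div_const _).mul
        (F.lin a).cont).mul (F.lin b).cont).mul continuousOn_id |>.mono hsub
    · filter_upwards [hne, hball 1 one_pos] with b hb hb1
      refine ae_of_all _ fun r hr => ?_
      rw [Set.uIoc_of_le hX.le] at hr
      have hr' := Ioc_subset_Icc_self hr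
      obtain ⟨-, -, -, h1, h2, -⟩ := H b hb1 r hr'
      have h3 := (H a (by simp) r hr').2.2.2.2.1
      have hr0 := hr'.1
      have hrX := hr'.2
      have hba : 0 < |b - a| := abs_pos.2 (sub_ne_zero.2 hb)
      rw [Real.norm_eq_abs, abs_mul, abs_mul, abs_mul, abs_div, abs_of_nonneg hr0]
      have h4 : |liouvilleDensity N (u b) r - liouvilleDensity N (u a) r| / |b - a| ≤ C := by
        rwa [div_le_iff₀ hba]
      gcongr
    · rw [Set.uIoc_of_le hX.le] at hr
      have hr' := Ioc_subset_Icc_self hr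
      have h1 : Tendsto (fun b => (liouvilleDensity N (u b) r - liouvilleDensity N (u a) r)
          / (b - a)) (nhdsWithin a {a}ᶜ) (nhds (2 * liouvilleDensity N (u a) r * φ a r)) := by
        rw [tendsto_iff_dist_tendsto_zero]
        have hz : Tendsto (fun b => C' * |b - a|) (nhdsWithin a {a}ᶜ) (nhds 0) := by
          have : Continuous fun b => C' * |b - a| := by fun_prop
          simpa using (this.tendsto a).mono_left nhdsWithin_le_nhds
        refine squeeze_zero' (Eventually.of_forall fun _ => dist_nonneg) ?_ hz
        filter_upwards [hne, hball ρ hρ] with b hb hb1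
        have h2 := (H' b hb1 r hr').2
        have hba : 0 < |b - a| := abs_pos.2 (sub_ne_zero.2 hb)
        have hba' : b - a ≠ 0 := sub_ne_zero.2 hb
        have h3 : (liouvilleDensity N (u b) r - liouvilleDensity N (u a) r) / (b - a) -
            2 * liouvilleDensity N (u a) r * φ a r =
            (liouvilleDensity N (u b) r - liouvilleDensity N (u a) r
              - (b - a) * (2 * liouvilleDensity N (u a) r * φ a r)) / (b - a) := by
          field_simp
        rw [Real.dist_eq, h3, abs_div, div_le_iff₀ hba]
        linarith
      have h2 := ((F.tendsto_apply hN a hr'.1).2.mono_left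
        (nhdsWithin_le_nhds : nhdsWithin a {a}ᶜ ≤ nhds a))
      exact ((h1.mul_const (φ a r)).mul h2).mul_const r
  have hlim2 := hlim.const_mul (2 / (X * s a X))
  have hval : 2 / (X * s a X) * ∫ r in (0 : ℝ)..X,
        2 * liouvilleDensity N (u a) r * φ a r * φ a r * φ a r * r =
      4 / (X * s a X) * ∫ r in (0 : ℝ)..X, liouvilleDensity N (u a) r * φ a r ^ 3 * r := by
    have : ∀ r, 2 * liouvilleDensity N (u a) r * φ a r * φ a r * φ a r * r =
        2 * (liouvilleDensity N (u a) r * φ a r ^ 3 * r) := fun r => by ring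
    simp only [this, intervalIntegral.integral_const_mul]
    ring
  rw [hval] at hlim2
  refine hlim2.congr' ?_
  filter_upwards [hne] with b hb
  have hba' : b - a ≠ 0 := sub_ne_zero.2 hb
  have hw := F.wronskian_identity a b hX.le
  have : ∀ r, -(2 * (liouvilleDensity N (u b) r - liouvilleDensity N (u a) r)
        * φ a r * φ b r * r) = (-2 * (b - a)) *
      ((liouvilleDensity N (u b) r - liouvilleDensity N (u a) r) / (b - a)
        * φ a r * φ b r * r) := fun r => by field_simp
  simp only [this, intervalIntegral.integral_const_mul, hz, mul_zero, zero_sub] at hw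
  rw [div_mul_eq_mul_div, div_eq_div_iff (by positivity) hba']
  linarith

lemma exists_mean_value {f f' : ℝ → ℝ} (hf : ∀ r, 0 < r → HasDerivAt f (f' r) r) {x y : ℝ}
    (hx : 0 < x) (hy : 0 < y) : ∃ ξ, |ξ - x| ≤ |y - x| ∧ 0 < ξ ∧ f x - f y = f' ξ * (x - y) := by
  have key : ∀ x y : ℝ, 0 < x → x < y → ∃ ξ ∈ Ioo x y, f y - f x = f' ξ * (y - x) := by
    intro x y hx hxy
    obtain ⟨ξ, hξ, h⟩ := exists_hasDerivAt_eq_slope f f' hxy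
      (fun r hr => (hf r (hx.trans_le hr.1)).continuousAt.continuousWithinAt)
      (fun r hr => hf r (hx.trans hr.1))
    refine ⟨ξ, hξ, ?_⟩
    rw [h, div_mul_cancel₀ _ (sub_ne_zero.2 hxy.ne')]
  rcases lt_trichotomy x y with h | h | h
  · obtain ⟨ξ, hξ, he⟩ := key x y hx h
    refine ⟨ξ, ?_, hx.trans hξ.1, by linarith⟩
    rw [abs_of_pos (by linarith [hξ.1]), abs_of_pos (by linarith)]
    linarith [hξ.2]
  · exact ⟨x, by simp, hx, by simp [h]⟩
  · obtain ⟨ξ, hξ, he⟩ := key y x hy h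
    refine ⟨ξ, ?_, hy.trans hξ.1, he⟩
    rw [abs_of_neg (by linarith [hξ.2]), abs_of_neg (by linarith)]
    linarith [hξ.1]

lemma hasDerivAt_largest_zero (F : LiouvilleFamily N u p φ s) (hN : 0 ≤ N) {a δ R₀ : ℝ}
    {R : ℝ → ℝ} (hδ : 0 < δ) (hR₀ : 1 ≤ R₀)
    (hdec : ∀ᶠ b in nhds a, ∀ r, R₀ ≤ r →
      2 * liouvilleDensity N (u b) r * r ^ 2 ≤ δ ^ 2 / 4 * r ^ (-δ))
    (hR : ∀ᶠ b in nhds a, IsGreatest {r : ℝ | 0 < r ∧ φ b r = 0} (R b)) (hRa : R₀ < R a) :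
    HasDerivAt R (-(4 / (R a * s a (R a) ^ 2)) *
      ∫ r in (0 : ℝ)..R a, liouvilleDensity N (u a) r * φ a r ^ 3 * r) a := by
  have hX : 0 < R a := by linarith
  have hz : φ a (R a) = 0 := hR.self_of_nhds.1.2
  have hs := F.lin_deriv_ne_zero hN a hX hz
  have hcont := F.continuousAt_largest_zero hN hδ hR₀ hdec hR hRa
  have hmv : ∀ b, ∃ ξ, IsGreatest {r : ℝ | 0 < r ∧ φ b r = 0} (R b) →
      |ξ - R a| ≤ |R b - R a| ∧ 0 < ξ ∧ φ b (R a) = s b ξ * (R a - R b) := by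
    intro b
    by_cases hb : IsGreatest {r : ℝ | 0 < r ∧ φ b r = 0} (R b)
    · obtain ⟨ξ, h1, h2, h3⟩ := exists_mean_value (F.lin b).hasDerivAt hX hb.1.1
      rw [hb.1.2, sub_zero] at h3
      exact ⟨ξ, fun _ => ⟨h1, h2, h3⟩⟩
    · exact ⟨0, fun h => absurd h hb⟩
  choose ξ hξ using hmv
  have hξlim : Tendsto ξ (nhds a) (nhds (R a)) := by
    rw [tendsto_iff_dist_tendsto_zero] at hcont ⊢
    refine squeeze_zero' (Eventually.of_forall fun _ => dist_nonneg) ?_ hcont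
    filter_upwards [hR] with b hb using (hξ b hb).1
  obtain ⟨C, hC, H⟩ := F.exists_bounds hN a (R a + 1) (by linarith)
  have hslim : Tendsto (fun b => s b (ξ b)) (nhds a) (nhds (s a (R a))) := by
    have h1 : Tendsto (fun b => s a (ξ b)) (nhds a) (nhds (s a (R a))) :=
      ((F.lin a).hasDerivAt_deriv _ hX).continuousAt.tendsto.comp hξlim
    have h2 : Tendsto (fun b => s b (ξ b) - s a (ξ b)) (nhds a) (nhds 0) := by
      have hz : Tendsto (fun b => C * |b - a|) (nhds a) (nhds 0) := by
        have : Continuous fun b => C * |b - a| := by fun_prop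
        simpa using this.tendsto a
      refine squeeze_zero_norm' ?_ hz
      filter_upwards [hR, Metric.closedBall_mem_nhds a one_pos,
        hξlim.eventually (gt_mem_nhds (show R a < R a + 1 by linarith))] with b hb hb1 hb2
      rw [Metric.mem_closedBall, Real.dist_eq] at hb1
      exact (H b hb1 (ξ b) ⟨(hξ b hb).2.1.le, hb2.le⟩).2.2.2.2.2.2.2
    simpa using h2.add h1
  rw [hasDerivAt_iff_tendsto_slope]
  have hq := ((F.tendsto_lin_div hN a hX hz).div (hslim.mono_left nhdsWithin_le_nhds) hs).neg
  have hval : -(4 / (R a * s a (R a)) *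
      (∫ r in (0 : ℝ)..R a, liouvilleDensity N (u a) r * φ a r ^ 3 * r) / s a (R a)) =
      -(4 / (R a * s a (R a) ^ 2)) *
      ∫ r in (0 : ℝ)..R a, liouvilleDensity N (u a) r * φ a r ^ 3 * r := by
    field_simp
  rw [hval] at hq
  refine hq.congr' ?_
  filter_upwards [nhdsWithin_le_nhds hR, eventually_mem_nhdsWithin,
    nhdsWithin_le_nhds (hslim.eventually_ne hs)] with b hb hne hsb
  have hba' : b - a ≠ 0 := sub_ne_zero.2 hne
  change -(φ b (R a) / (b - a) / s b (ξ b)) = slope R a b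
  rw [(hξ b hb).2.2, slope_def_field]
  field_simp
  ring

/-- An integrable majorant, locally uniform in the initial value, for the integrand of `J_N`. -/
lemma exists_integrable_majorant (F : LiouvilleFamily N u p φ s) (hN : 0 ≤ N) {a δ R₀ : ℝ}
    (hδ : 0 < δ) (hR₀ : 1 ≤ R₀)
    (hdec : ∀ᶠ b in nhds a, ∀ r, R₀ ≤ r →
      2 * liouvilleDensity N (u b) r * r ^ 2 ≤ δ ^ 2 / 4 * r ^ (-δ)) :
    ∃ g : ℝ → ℝ, IntegrableOn g (Ioi 0) ∧ ∀ᶠ b in nhds a, ∀ r, 0 < r →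
      |liouvilleDensity N (u b) r * φ b r ^ 3 * r| ≤ g r := by
  have hR0 : 0 < R₀ := by linarith
  obtain ⟨C, hC, H⟩ := F.exists_bounds hN a R₀ hR0.le
  set K := C + 2 / δ * (R₀ * C) with hK
  have hK0 : 0 < K := by positivity
  refine ⟨fun r => (Ioc 0 R₀).indicator (fun _ => C * C ^ 3 * R₀) r +
    (Ioi R₀).indicator (fun r => δ ^ 2 / 8 * K ^ 3 * r ^ (-1 - δ / 4)) r, ?_, ?_⟩
  · refine Integrable.add (Integrable.integrableOn ?_) (Integrable.integrableOn ?_)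
    · rw [integrable_indicator_iff measurableSet_Ioc]
      exact integrableOn_const (by simp)
    · rw [integrable_indicator_iff measurableSet_Ioi]
      exact (integrableOn_Ioi_rpow_of_lt (by linarith) hR0).const_mul _
  · filter_upwards [hdec, Metric.closedBall_mem_nhds a one_pos] with b hb hb1 r hr
    rw [Metric.mem_closedBall, Real.dist_eq] at hb1
    have hd := liouvilleDensity_pos N (u b) r
    rw [abs_mul, abs_mul, abs_of_pos hd, abs_of_pos hr, abs_pow]
    rcases le_or_gt r R₀ with h | h
    · rw [indicator_of_mem (show r ∈ Ioc 0 R₀ from ⟨hr, h⟩),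
        indicator_of_notMem (show r ∉ Ioi R₀ from not_lt.2 h), add_zero]
      obtain ⟨h1, -, -, -, h2, -⟩ := H b hb1 r ⟨hr.le, h⟩
      gcongr
    · rw [indicator_of_notMem (show r ∉ Ioc 0 R₀ from fun hx => not_lt.2 hx.2 h),
        indicator_of_mem (show r ∈ Ioi R₀ from h), zero_add]
      obtain ⟨-, -, -, -, h2, h3, -⟩ := H b hb1 R₀ ⟨hR0.le, le_rfl⟩
      have h4 := (F.lin b).sq_le_mul_rpow hR₀ hδ (fun r hr =>
        ⟨by linarith [liouvilleDensity_pos N (u b) r], hb r hr⟩) h.le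
      have h5 : |φ b r| ≤ K * r ^ (δ / 4) := by
        refine abs_le_of_sq_le_sq (h4.trans ?_) (by positivity)
        have h6 : (K * r ^ (δ / 4)) ^ 2 = K ^ 2 * r ^ (δ / 2) := by
          rw [mul_pow, ← Real.rpow_natCast (r ^ (δ / 4)), ← Real.rpow_mul hr.le]
          congr 2
          push_cast
          ring
        rw [h6]
        gcongr
        have h7 : φ b R₀ ^ 2 ≤ C ^ 2 := sq_le_sq' (abs_le.1 h2).1 (abs_le.1 h2).2
        have h8 : s b R₀ ^ 2 ≤ C ^ 2 := sq_le_sq' (abs_le.1 h3).1 (abs_le.1 h3).2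
        have h9 : K ^ 2 = C ^ 2 + 4 / δ ^ 2 * (R₀ ^ 2 * C ^ 2) + 4 / δ * (R₀ * C * C) := by
          rw [hK]; field_simp; ring
        rw [h9, mul_pow]
        have h10 : 0 ≤ 4 / δ * (R₀ * C * C) := by positivity
        have h11 : 4 / δ ^ 2 * (R₀ ^ 2 * s b R₀ ^ 2) ≤ 4 / δ ^ 2 * (R₀ ^ 2 * C ^ 2) := by gcongr
        linarith
      have h6 : liouvilleDensity N (u b) r * r ≤ δ ^ 2 / 8 * r ^ (-δ) / r := by
        rw [le_div_iff₀ hr]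
        linarith [hb r h.le]
      calc liouvilleDensity N (u b) r * |φ b r| ^ 3 * r
          = (liouvilleDensity N (u b) r * r) * |φ b r| ^ 3 := by ring
        _ ≤ (δ ^ 2 / 8 * r ^ (-δ) / r) * (K * r ^ (δ / 4)) ^ 3 := by gcongr
        _ = δ ^ 2 / 8 * K ^ 3 * (r ^ (-δ) * (r ^ (δ / 4)) ^ 3 * r ^ (-1 : ℝ)) := by
          rw [Real.rpow_neg_one]; ring
        _ = δ ^ 2 / 8 * K ^ 3 * r ^ (-1 - δ / 4) := by
          rw [← Real.rpow_natCast (r ^ (δ / 4)), ← Real.rpow_mul hr.le, ← Real.rpow_add hr,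
            ← Real.rpow_add hr]
          congr 2
          push_cast
          ring

lemma aestronglyMeasurable_integrand (F : LiouvilleFamily N u p φ s) (b : ℝ) :
    AEStronglyMeasurable (fun r => liouvilleDensity N (u b) r * φ b r ^ 3 * r)
      (volume.restrict (Ioi 0)) := by
  refine ContinuousOn.aestronglyMeasurable ?_ measurableSet_Ioi
  exact (((F.continuousOn_density b).mul ((F.lin b).cont.pow 3)).mul continuousOn_id).mono
    Ioi_subset_Ici_self

lemma tendsto_integrand (F : LiouvilleFamily N u p φ s) (hN : 0 ≤ N) (a : ℝ) {r : ℝ}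
    (hr : 0 < r) : Tendsto (fun b => liouvilleDensity N (u b) r * φ b r ^ 3 * r) (nhds a)
      (nhds (liouvilleDensity N (u a) r * φ a r ^ 3 * r)) := by
  obtain ⟨h1, h2⟩ := F.tendsto_apply hN a hr.le
  exact (h1.mul (h2.pow 3)).mul_const r

lemma tendsto_JN (F : LiouvilleFamily N u p φ s) (hN : 0 ≤ N) {a δ R₀ : ℝ}
    (hδ : 0 < δ) (hR₀ : 1 ≤ R₀)
    (hdec : ∀ᶠ b in nhds a, ∀ r, R₀ ≤ r →
      2 * liouvilleDensity N (u b) r * r ^ 2 ≤ δ ^ 2 / 4 * r ^ (-δ)) :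
    Tendsto (fun b => JN N (u b) (φ b)) (nhds a) (nhds (JN N (u a) (φ a))) := by
  obtain ⟨g, hg, hle⟩ := F.exists_integrable_majorant hN hδ hR₀ hdec
  refine tendsto_integral_filter_of_dominated_convergence g
    (Eventually.of_forall F.aestronglyMeasurable_integrand) ?_ hg ?_
  · filter_upwards [hle] with b hb
    filter_upwards [ae_restrict_mem measurableSet_Ioi] with r hr using hb r hr
  · filter_upwards [ae_restrict_mem measurableSet_Ioi] with r hr using F.tendsto_integrand hN a hr

lemma tendsto_truncated_JN (F : LiouvilleFamily N u p φ s) (hN : 0 ≤ N) {a δ R₀ : ℝ}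
    (hδ : 0 < δ) (hR₀ : 1 ≤ R₀)
    (hdec : ∀ᶠ b in nhds a, ∀ r, R₀ ≤ r →
      2 * liouvilleDensity N (u b) r * r ^ 2 ≤ δ ^ 2 / 4 * r ^ (-δ))
    {R : ℝ → ℝ} {S : Set ℝ} (hlim : Tendsto R (nhdsWithin a S) atTop) :
    Tendsto (fun b => ∫ r in Ioo 0 (R b), liouvilleDensity N (u b) r * φ b r ^ 3 * r)
      (nhdsWithin a S) (nhds (JN N (u a) (φ a))) := by
  obtain ⟨g, hg, hle⟩ := F.exists_integrable_majorant hN hδ hR₀ hdec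
  have heq : ∀ b, ∫ r in Ioo 0 (R b), liouvilleDensity N (u b) r * φ b r ^ 3 * r =
      ∫ r in Ioi 0, (Iio (R b)).indicator
        (fun r => liouvilleDensity N (u b) r * φ b r ^ 3 * r) r := fun b => by
    rw [setIntegral_indicator measurableSet_Iio, Ioi_inter_Iio]
  simp only [heq]
  refine tendsto_integral_filter_of_dominated_convergence g (Eventually.of_forall fun b =>
    (F.aestronglyMeasurable_integrand b).indicator measurableSet_Iio) ?_ hg ?_
  · filter_upwards [nhdsWithin_le_nhds hle] with b hb
    filter_upwards [ae_restrict_mem measurableSet_Ioi] with r hr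
    exact (norm_indicator_le_norm_self _ _).trans (hb r hr)
  · filter_upwards [ae_restrict_mem measurableSet_Ioi] with r hr
    refine ((F.tendsto_integrand hN a hr).mono_left nhdsWithin_le_nhds).congr' ?_
    filter_upwards [hlim.eventually_gt_atTop r] with b hb
    rw [indicator_of_mem (show r ∈ Iio (R b) from hb)]

end LiouvilleFamily

/-- Dynamics of the largest zero `r(a)` of `φ_a`: if `r(a)` is well defined for `a`
on one side of `ā` (`ζ = ±1` selects the side) and `r(a) → ∞` as `a → ā` from that
side, then near `ā` on that side `a ↦ r(a)` is differentiable with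
`r'(a) = −(4/(r(a)|φ_a'(r(a))|²)) ∫₀^{r(a)} (1+r²)^N e^{2u_a} φ_a³ r dr`, and if
`J_N(ā) ≠ 0` then `r'(a) J_N(a) < 0` there. -/
theorem largest_zero_dynamics (N : ℝ) (hN : 0 < N) (abar ζ : ℝ)
    (hζ : ζ = 1 ∨ ζ = -1)
    (u : ℝ → ℝ → ℝ) (hu : ∀ a : ℝ, IsSol N (u a) ∧ u a 0 = a)
    (φ : ℝ → ℝ → ℝ) (hφ : ∀ a : ℝ, IsLin N (u a) (φ a))
    (R : ℝ → ℝ) (hR : ∀ a : ℝ, R a = sSup {r : ℝ | 0 < r ∧ φ a r = 0})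
    (hmax : ∃ δ > 0, ∀ a : ℝ, 0 < ζ * (a - abar) → ζ * (a - abar) < δ →
      ∃ rmax : ℝ, IsGreatest {r : ℝ | 0 < r ∧ φ a r = 0} rmax)
    (hlim : Tendsto R (nhdsWithin abar {a : ℝ | 0 < ζ * (a - abar)}) atTop) :
    ∃ ε > 0, ∀ a ∈ (if ζ = -1 then Ioo (abar - ε) abar else Ioo abar (abar + ε)),
      HasDerivAt R
        (-(4 / (R a * (deriv (φ a) (R a)) ^ 2)) *
          ∫ r in Ioo (0:ℝ) (R a),
            (1 + r ^ 2) ^ N * Real.exp (2 * u a r) * (φ a r) ^ 3 * r) a ∧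
      (JN N (u abar) (φ abar) ≠ 0 → deriv R a * JN N (u a) (φ a) < 0) := by
  have F : LiouvilleFamily N u (fun a => derivWithin (u a) (Ici 0)) φ
      (fun a => derivWithin (φ a) (Ici 0)) :=
    { sol := fun a => RadialODE.of_contDiffOn (hu a).1.1 (hu a).1.2.1 (hu a).1.2.2.1
      sol_zero := fun a => (hu a).2
      lin := fun a => RadialODE.of_contDiffOn (hφ a).1 (fun r hr => by
        simpa only [liouvilleDensity, mul_assoc] using (hφ a).2.1 r hr) (hφ a).2.2.2
      lin_zero := fun a => (hφ a).2.2.1 }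
  obtain ⟨d, R₀, hd, hR₀, hdec⟩ := F.exists_uniform_decay hN.le abar (hu abar).1.2.2.2
  obtain ⟨δ, hδ, hmax⟩ := hmax
  set S : Set ℝ := {a : ℝ | 0 < ζ * (a - abar)} with hS
  have hcont : Continuous fun a => ζ * (a - abar) := by fun_prop
  have hSopen : IsOpen S := isOpen_lt continuous_const hcont
  have hgreat : ∀ᶠ a in nhds abar, a ∈ S → IsGreatest {r : ℝ | 0 < r ∧ φ a r = 0} (R a) := by
    have : ∀ᶠ a in nhds abar, ζ * (a - abar) < δ :=
      (hcont.tendsto abar).eventually (gt_mem_nhds (by simpa using hδ))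
    filter_upwards [this] with a ha haS
    obtain ⟨r, hr⟩ := hmax a haS ha
    rwa [hR a, hr.csSup_eq]
  have hsign : JN N (u abar) (φ abar) ≠ 0 → ∀ᶠ a in nhdsWithin abar S,
      0 < (∫ r in Ioo 0 (R a), liouvilleDensity N (u a) r * φ a r ^ 3 * r) * JN N (u a) (φ a) :=
    fun hJ => ((F.tendsto_truncated_JN hN.le hd hR₀ hdec hlim).mul
      ((F.tendsto_JN hN.le hd hR₀ hdec).mono_left nhdsWithin_le_nhds)).eventually
        (lt_mem_nhds (mul_self_pos.2 hJ))
  have hev : ∀ᶠ a in nhdsWithin abar S, a ∈ S ∧ R₀ < R a ∧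
      (∀ᶠ b in nhds a, ∀ r, R₀ ≤ r →
        2 * liouvilleDensity N (u b) r * r ^ 2 ≤ d ^ 2 / 4 * r ^ (-d)) ∧
      (∀ᶠ b in nhds a, b ∈ S → IsGreatest {r : ℝ | 0 < r ∧ φ b r = 0} (R b)) ∧
      (JN N (u abar) (φ abar) ≠ 0 →
        0 < (∫ r in Ioo 0 (R a), liouvilleDensity N (u a) r * φ a r ^ 3 * r)
          * JN N (u a) (φ a)) := by
    filter_upwards [eventually_mem_nhdsWithin, hlim.eventually_gt_atTop R₀,
      nhdsWithin_le_nhds hdec.eventually_nhds, nhdsWithin_le_nhds hgreat.eventually_nhds,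
      eventually_imp_distrib_left.2 hsign] with a h1 h2 h3 h4 h5 using ⟨h1, h2, h3, h4, h5⟩
  obtain ⟨ε, hε, hball⟩ := Metric.mem_nhdsWithin_iff.1 hev
  refine ⟨ε, hε, fun a ha => ?_⟩
  have hmem : a ∈ Metric.ball abar ε ∩ S := by
    rw [Real.ball_eq_Ioo]
    rcases hζ with rfl | rfl
    · rw [if_neg (by norm_num)] at ha
      exact ⟨⟨by linarith [ha.1], ha.2⟩, by simpa [hS] using ha.1⟩
    · rw [if_pos rfl] at ha
      exact ⟨⟨ha.1, by linarith [ha.2]⟩, by simpa [hS] using ha.2⟩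
  obtain ⟨haS, hRa, hda, hga, hsa⟩ := hball hmem
  have hga' : ∀ᶠ b in nhds a, IsGreatest {r : ℝ | 0 < r ∧ φ b r = 0} (R b) := by
    filter_upwards [hga, hSopen.mem_nhds haS] with b hb hbS using hb hbS
  have hRpos : 0 < R a := by linarith
  have hderiv := F.hasDerivAt_largest_zero hN.le hd hR₀ hda hga' hRa
  have hs := F.lin_deriv_ne_zero hN.le a hRpos hga'.self_of_nhds.1.2
  rw [← ((F.lin a).hasDerivAt _ hRpos).deriv] at hderiv hs
  rw [intervalIntegral.integral_of_le hRpos.le, integral_Ioc_eq_integral_Ioo] at hderiv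
  refine ⟨hderiv, fun hJ => ?_⟩
  rw [hderiv.deriv, mul_assoc]
  exact mul_neg_of_neg_of_pos (neg_lt_zero.2 (by positivity)) (hsa hJ)
end
end

section
/- Let k ≥ 2 be an integer, N_k := k(k+1) − 2, and a*_{N_k} := (1/2) log(2(N_k+2)). Then j(k) := J_{N_k}(a*_{N_k}) satisfies j(k) = (1/2) k(k+1) ∫_{−1}^{1} P_k(s)³ ds; consequently j(k) = 0 if k is odd, and j(k) > 0 if k is even. -/
open Real Set MeasureTheory Filter

noncomputable section

/-- The Legendre polynomial of degree `k`, via Rodrigues' formula. -/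
def legP (k : ℕ) (s : ℝ) : ℝ :=
  (1 / ((2 : ℝ) ^ k * (Nat.factorial k : ℝ))) *
    iteratedDeriv k (fun x : ℝ => (x ^ 2 - 1) ^ k) s

namespace Legendre

open Polynomial

/-- The Legendre polynomials, defined by
`(n + 1) P_{n+1} = (X² - 1) P_n' + (n + 1) X P_n` and `P_0 = 1`. -/
def poly : ℕ → ℝ[X]
  | 0 => 1
  | n + 1 => C (1 / ((n : ℝ) + 1)) * ((X ^ 2 - 1) * derivative (poly n)) + X * poly n

lemma poly_succ_mul (n : ℕ) : ((n : ℝ[X]) + 1) * poly (n + 1) =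
    (X ^ 2 - 1) * derivative (poly n) + ((n : ℝ[X]) + 1) * X * poly n := by
  have h : ((n : ℝ[X]) + 1) * C (1 / ((n : ℝ) + 1)) = 1 := by
    have : ((n : ℝ[X]) + 1) = C ((n : ℝ) + 1) := by simp
    rw [this, ← C_mul, mul_one_div_cancel (by positivity), C_1]
  rw [poly]
  linear_combination ((X ^ 2 - 1) * derivative (poly n)) * h

lemma natCast_succ_ne_zero (n : ℕ) : (n : ℝ[X]) + 1 ≠ 0 := by exact_mod_cast n.succ_ne_zero

lemma derivative_sq_sub_one_mul (n : ℕ) :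
    derivative ((X ^ 2 - 1) * derivative (poly n)) = (n : ℝ[X]) * ((n : ℝ[X]) + 1) * poly n := by
  induction n with
  | zero => simp [poly]
  | succ n ih =>
    have h0 := poly_succ_mul n
    have h1 := congrArg derivative h0
    simp only [derivative_mul, derivative_add, derivative_sub, derivative_X_pow, derivative_one,
      derivative_natCast, derivative_X] at h1 ih
    have h2 : derivative (poly (n + 1)) =
        X * derivative (poly n) + ((n : ℝ[X]) + 1) * poly n := by
      refine mul_left_cancel₀ (natCast_succ_ne_zero n) ?_
      linear_combination h1 + ih
    have h3 : (X ^ 2 - 1) * derivative (poly (n + 1)) =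
        ((n : ℝ[X]) + 1) * (X * poly (n + 1) - poly n) := by
      rw [h2]; linear_combination -X * h0
    rw [h3]
    simp only [derivative_mul, derivative_add, derivative_sub, derivative_one,
      derivative_natCast, derivative_X, h2]
    push_cast
    linear_combination -((n : ℝ[X]) + 1) * h0

lemma derivative_poly_succ (n : ℕ) : derivative (poly (n + 1)) =
    X * derivative (poly n) + ((n : ℝ[X]) + 1) * poly n := by
  have h1 := congrArg derivative (poly_succ_mul n)
  have ih := derivative_sq_sub_one_mul n
  simp only [derivative_mul, derivative_add, derivative_sub, derivative_X_pow, derivative_one,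
    derivative_natCast, derivative_X] at h1 ih
  refine mul_left_cancel₀ (natCast_succ_ne_zero n) ?_
  linear_combination h1 + ih

lemma poly_add_two_mul (n : ℕ) : ((n : ℝ[X]) + 2) * poly (n + 2) =
    (2 * (n : ℝ[X]) + 3) * X * poly (n + 1) - ((n : ℝ[X]) + 1) * poly n := by
  have h0 := poly_succ_mul n
  have h1 := poly_succ_mul (n + 1)
  rw [derivative_poly_succ] at h1
  push_cast at h1
  linear_combination h1 - X * h0

/-- The three-term recurrence, with the convention that the coefficient of `P_{-1}` vanishes. -/
lemma X_mul_poly (n : ℕ) : (2 * (n : ℝ[X]) + 1) * (X * poly n) =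
    ((n : ℝ[X]) + 1) * poly (n + 1) + (n : ℝ[X]) * poly (n - 1) := by
  cases n with
  | zero => simp [poly]
  | succ n =>
    have := poly_add_two_mul n
    rw [Nat.add_sub_cancel]
    push_cast
    linear_combination -this

lemma eval_one_poly (n : ℕ) : (poly n).eval 1 = 1 := by
  induction n with
  | zero => simp [poly]
  | succ n ih => simp [poly, ih]

lemma poly_comp_neg_X (n : ℕ) : (poly n).comp (-X) = (-1) ^ n * poly n := by
  induction n with
  | zero => simp [poly]
  | succ n ih =>
    have h := congrArg derivative ih
    rw [derivative_comp] at h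
    have h' : derivative ((-1 : ℝ[X]) ^ n) = 0 := by
      rcases neg_one_pow_eq_or ℝ[X] n with h | h <;> simp [h]
    simp only [derivative_neg, derivative_X, derivative_mul, h'] at h
    simp only [poly, add_comp, mul_comp, C_comp, sub_comp, pow_comp, X_comp, one_comp, ih]
    rw [pow_succ]
    linear_combination -(C (1 / ((n : ℝ) + 1)) * ((X ^ 2 - 1))) * h

lemma iterate_derivative_sq_sub_one_pow (n : ℕ) :
    derivative^[n + 1] ((X ^ 2 - 1 : ℝ[X]) ^ (n + 1)) =
      2 * (X ^ 2 - 1) * derivative^[n + 1] ((X ^ 2 - 1 : ℝ[X]) ^ n) +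
        2 * ((n : ℝ[X]) + 1) * X * derivative^[n] ((X ^ 2 - 1 : ℝ[X]) ^ n) := by
  set q : ℝ[X] := (X ^ 2 - 1) ^ n with hq
  have h1 : derivative^[n + 1] ((X ^ 2 - 1 : ℝ[X]) ^ (n + 1)) =
      2 * ((n : ℝ[X]) + 1) * (derivative^[n] q * X + n • derivative^[n - 1] q) := by
    rw [Function.iterate_succ_apply]
    have : derivative ((X ^ 2 - 1 : ℝ[X]) ^ (n + 1)) = ((2 * (n + 1) : ℕ) : ℝ[X]) * (q * X) := by
      rw [derivative_pow_succ]
      simp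
      ring
    rw [this, iterate_derivative_natCast_mul, iterate_derivative_mul_X]
    push_cast
    ring
  have h2 : derivative^[n + 1] ((X ^ 2 - 1 : ℝ[X]) ^ (n + 1)) =
      (X ^ 2 - 1) * derivative^[n + 1] q + 2 * ((n : ℝ[X]) + 1) * X * derivative^[n] q +
        ((n : ℝ[X]) + 1) * (n : ℝ[X]) * derivative^[n - 1] q := by
    have : (X ^ 2 - 1 : ℝ[X]) ^ (n + 1) = (q * X) * X - q := by rw [hq]; ring
    rw [this, iterate_derivative_sub, iterate_derivative_mul_X, iterate_derivative_mul_X,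
      Nat.add_sub_cancel, iterate_derivative_mul_X]
    simp only [nsmul_eq_mul]
    push_cast
    ring
  simp only [nsmul_eq_mul] at h1
  linear_combination 2 * h2 - h1

lemma iterate_derivative_eq_mul_poly (n : ℕ) :
    derivative^[n] ((X ^ 2 - 1 : ℝ[X]) ^ n) = C ((2 : ℝ) ^ n * n.factorial) * poly n := by
  induction n with
  | zero => simp [poly]
  | succ n ih =>
    rw [iterate_derivative_sq_sub_one_pow, Function.iterate_succ_apply', ih, derivative_C_mul,
      Nat.factorial_succ]
    have := poly_succ_mul n
    simp only [map_mul, map_pow, Nat.cast_mul, pow_succ, Nat.cast_succ, map_add,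
      map_natCast, map_one, C_ofNat]
    linear_combination -2 * 2 ^ n * (n.factorial : ℝ[X]) * this

lemma iteratedDeriv_eval (p : ℝ[X]) (n : ℕ) :
    iteratedDeriv n (fun x => p.eval x) = fun x => (derivative^[n] p).eval x := by
  induction n with
  | zero => simp
  | succ n ih =>
    rw [iteratedDeriv_succ, ih, Function.iterate_succ_apply']
    ext x
    simp

lemma legP_eq_eval (n : ℕ) (s : ℝ) : legP n s = (poly n).eval s := by
  have h : (fun x : ℝ => (x ^ 2 - 1) ^ n) = fun x => ((X ^ 2 - 1 : ℝ[X]) ^ n).eval x := by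
    ext x; simp
  rw [legP, h, iteratedDeriv_eval, iterate_derivative_eq_mul_poly]
  simp only [eval_C_mul]
  field_simp

/-- Integration of polynomials over `[-1, 1]`. -/
def integral : ℝ[X] →ₗ[ℝ] ℝ where
  toFun p := ∫ s in (-1 : ℝ)..1, p.eval s
  map_add' p q := by
    simp only [eval_add]
    exact intervalIntegral.integral_add (p.continuous.intervalIntegrable _ _)
      (q.continuous.intervalIntegrable _ _)
  map_smul' c p := by simp [eval_smul]

lemma integral_apply (p : ℝ[X]) : integral p = ∫ s in (-1 : ℝ)..1, p.eval s := rfl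

lemma integral_derivative (p : ℝ[X]) : integral (derivative p) = p.eval 1 - p.eval (-1) :=
  intervalIntegral.integral_eq_sub_of_hasDerivAt (fun x _ => p.hasDerivAt x)
    ((derivative p).continuous.intervalIntegrable _ _)

lemma integral_comp_neg_X (p : ℝ[X]) : integral (p.comp (-X)) = integral p := by
  simp only [integral_apply, eval_comp, eval_neg, eval_X]
  rw [intervalIntegral.integral_comp_neg (fun x => p.eval x), neg_neg]

lemma integral_C_mul (c : ℝ) (p : ℝ[X]) : integral (C c * p) = c * integral p := by
  rw [C_mul', map_smul, smul_eq_mul]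

lemma integral_poly_mul_poly {m n : ℕ} (h : m ≠ n) : integral (poly m * poly n) = 0 := by
  have hm := derivative_sq_sub_one_mul m
  have hn := derivative_sq_sub_one_mul n
  have key : derivative ((X ^ 2 - 1) * derivative (poly m) * poly n
      - (X ^ 2 - 1) * derivative (poly n) * poly m) =
      C ((m : ℝ) * (m + 1) - n * (n + 1)) * (poly m * poly n) := by
    rw [derivative_sub, derivative_mul (g := poly n), derivative_mul (g := poly m), hm, hn]
    simp only [map_mul, map_sub, map_add, map_natCast, map_one]
    ring
  have h1 := congrArg integral key
  rw [integral_derivative, integral_C_mul] at h1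
  simp only [eval_sub, eval_mul, eval_pow, eval_X, eval_one] at h1
  norm_num at h1
  refine h1.resolve_left fun h2 => h ?_
  have h3 : ((m : ℝ) - n) * (m + n + 1) = 0 := by linear_combination h2
  rcases mul_eq_zero.mp h3 with h4 | h4
  · exact_mod_cast sub_eq_zero.mp h4
  · exact absurd h4 (by positivity)

/-- The integral of a product of three Legendre polynomials. -/
def triple (a b c : ℕ) : ℝ := integral (poly a * poly b * poly c)

lemma triple_comm (a b c : ℕ) : triple a b c = triple b a c := by
  rw [triple, triple, mul_comm (poly a)]

lemma integral_X_mul_triple (a b c : ℕ) :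
    (2 * (a : ℝ) + 1) * integral (X * (poly a * poly b * poly c)) =
      (a + 1) * triple (a + 1) b c + a * triple (a - 1) b c := by
  have h : C (2 * (a : ℝ) + 1) * (X * (poly a * poly b * poly c)) =
      C ((a : ℝ) + 1) * (poly (a + 1) * poly b * poly c) +
        C (a : ℝ) * (poly (a - 1) * poly b * poly c) := by
    have := X_mul_poly a
    simp only [map_mul, map_add, map_natCast, map_one, C_ofNat]
    linear_combination poly b * poly c * this
  rw [← integral_C_mul, h, map_add, integral_C_mul, integral_C_mul, triple, triple]

lemma triple_recurrence (a b c : ℕ) :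
    (2 * (b : ℝ) + 1) * ((a + 1) * triple (a + 1) b c + a * triple (a - 1) b c) =
      (2 * (a : ℝ) + 1) * ((b + 1) * triple a (b + 1) c + b * triple a (b - 1) c) := by
  have h1 := integral_X_mul_triple a b c
  have h2 := integral_X_mul_triple b a c
  rw [mul_comm (poly b), triple_comm (b + 1), triple_comm (b - 1)] at h2
  linear_combination (2 * (a : ℝ) + 1) * h2 - (2 * (b : ℝ) + 1) * h1

lemma integral_poly_sq (n : ℕ) : integral (poly n * poly n) = 2 / (2 * n + 1) := by
  induction n with
  | zero => norm_num [poly, integral_apply]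
  | succ n ih =>
    have h := triple_recurrence n (n + 1) 0
    have h0 : poly 0 = 1 := rfl
    simp only [triple, h0, mul_one] at h
    rw [integral_poly_mul_poly (by lia : n - 1 ≠ n + 1),
      integral_poly_mul_poly (by lia : n ≠ n + 1 + 1), Nat.add_sub_cancel, ih] at h
    push_cast at h ⊢
    field_simp at h ⊢
    refine mul_left_cancel₀ (by positivity : (n : ℝ) + 1 ≠ 0) ?_
    linear_combination h

/-- The coefficients `(2n)! / (2ⁿ n!²)`, extended by zero to negative integers. -/
def coeff : ℤ → ℝ
  | Int.ofNat n => ∏ i ∈ Finset.range n, (2 * (i : ℝ) + 1) / (i + 1)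
  | Int.negSucc _ => 0

lemma coeff_of_neg {n : ℤ} (hn : n < 0) : coeff n = 0 := by
  obtain ⟨m, rfl⟩ := Int.eq_negSucc_of_lt_zero hn
  rfl

lemma coeff_zero : coeff 0 = 1 := by
  change ∏ i ∈ Finset.range 0, (2 * (i : ℝ) + 1) / (i + 1) = 1
  simp

lemma coeff_pos {n : ℤ} (hn : 0 ≤ n) : 0 < coeff n := by
  lift n to ℕ using hn
  exact Finset.prod_pos fun i _ => by positivity

lemma add_one_mul_coeff (n : ℤ) : ((n : ℝ) + 1) * coeff (n + 1) = (2 * n + 1) * coeff n := by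
  rcases lt_trichotomy n (-1) with h | rfl | h
  · rw [coeff_of_neg (n := n + 1) (by lia), coeff_of_neg (by lia), mul_zero, mul_zero]
  · simp [coeff_of_neg]
  · lift n to ℕ using (by lia)
    change ((n : ℝ) + 1) * ∏ i ∈ Finset.range (n + 1), (2 * (i : ℝ) + 1) / (i + 1) =
      (2 * n + 1) * ∏ i ∈ Finset.range n, (2 * (i : ℝ) + 1) / (i + 1)
    rw [Finset.prod_range_succ]
    field_simp

/-- The product formula `∫ P_a P_b P_c = 2 A_x A_y A_z / ((2s + 1) A_s)`, where
`a = y + z`, `b = x + z`, `c = x + y` and `s = x + y + z`. -/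
lemma triple_mul_coeff (a b c : ℕ) (x y z : ℤ) (ha : (a : ℤ) = y + z) (hb : (b : ℤ) = x + z)
    (hc : (c : ℤ) = x + y) :
    triple a b c * ((2 * (x + y + z) + 1) * coeff (x + y + z)) =
      2 * (coeff x * coeff y * coeff z) := by
  induction a using Nat.strong_induction_on generalizing b c x y z with
  | _ a ih =>
  obtain _ | a := a
  · obtain rfl : y = -z := by push_cast at ha; lia
    have ht : triple 0 b c = integral (poly b * poly c) := by simp [triple, poly]
    rw [ht]
    rcases lt_trichotomy z 0 with hz | rfl | hz
    · rw [integral_poly_mul_poly (by lia), coeff_of_neg hz]; ring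
    · obtain rfl : b = c := by lia
      have hx : (x : ℝ) = b := by exact_mod_cast (by lia : x = (b : ℤ))
      rw [integral_poly_sq]
      simp only [Int.neg_zero, add_zero, coeff_zero, Int.cast_zero, hx]
      field_simp
    · rw [integral_poly_mul_poly (by lia), coeff_of_neg (n := -z) (by lia)]; ring
  · push_cast at ha
    have hs : 1 ≤ x + y + z := by lia
    have hrec := triple_recurrence a b c
    have h3 := ih a (by lia) (b + 1) c (x + 1) (y - 1) z (by lia) (by push_cast; lia) (by lia)
    have hx := add_one_mul_coeff x
    have hy := add_one_mul_coeff (y - 1)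
    have hz := add_one_mul_coeff (z - 1)
    have hsg := add_one_mul_coeff (x + y + z - 1)
    have hpos : 0 < coeff (x + y + z) := coeff_pos (by lia)
    rw [sub_add_cancel] at hy hz hsg
    push_cast at hx hy hz hsg h3
    rw [show x + 1 + (y - 1) + z = x + y + z by ring] at h3
    have h4 : (b : ℝ) * triple a (b - 1) c * ((x + y + z) * coeff (x + y + z)) =
        2 * b * (coeff x * coeff y * coeff (z - 1)) := by
      rcases Nat.eq_zero_or_pos b with rfl | hb0
      · simp
      · have h := ih a (by lia) (b - 1) c x y (z - 1) (by lia) (by lia) (by lia)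
        rw [show x + y + (z - 1) = x + y + z - 1 by ring] at h
        push_cast at h
        linear_combination (b : ℝ) * h + (b : ℝ) * triple a (b - 1) c * hsg
    have h2 : (a : ℝ) * triple (a - 1) b c * ((x + y + z) * coeff (x + y + z)) =
        2 * a * (coeff (x + 1) * coeff (y - 1) * coeff (z - 1)) := by
      rcases Nat.eq_zero_or_pos a with rfl | ha0
      · simp
      · have h := ih (a - 1) (by lia) b c (x + 1) (y - 1) (z - 1) (by lia) (by lia) (by lia)
        rw [show x + 1 + (y - 1) + (z - 1) = x + y + z - 1 by ring] at h
        push_cast at h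
        linear_combination (a : ℝ) * h + (a : ℝ) * triple (a - 1) b c * hsg
    have odd_ne (n : ℤ) : (2 * (n : ℝ) + 1) ≠ 0 := by
      exact_mod_cast (by lia : 2 * n + 1 ≠ 0)
    have odd_ne' (n : ℤ) : (2 * (n : ℝ) - 1) ≠ 0 := by
      exact_mod_cast (by lia : 2 * n - 1 ≠ 0)
    have hx0 := odd_ne x
    have hy0 := odd_ne' y
    have hz0 := odd_ne' z
    have hb' : (b : ℝ) = x + z := by exact_mod_cast hb
    have ha' : (a : ℝ) = y + z - 1 := by
      exact_mod_cast (by lia : (a : ℤ) = y + z - 1)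
    have hS : (1 : ℝ) ≤ x + y + z := by exact_mod_cast hs
    have hX : coeff x = (x + 1) / (2 * x + 1) * coeff (x + 1) := by
      rw [div_mul_eq_mul_div, eq_div_iff hx0]; linear_combination -hx
    have hY : coeff (y - 1) = y / (2 * y - 1) * coeff y := by
      rw [div_mul_eq_mul_div, eq_div_iff hy0]; linear_combination -hy
    have hZ : coeff (z - 1) = z / (2 * z - 1) * coeff z := by
      rw [div_mul_eq_mul_div, eq_div_iff hz0]; linear_combination -hz
    have hb0 : (0 : ℝ) < 2 * b + 1 := by positivity
    have ha0 : (0 : ℝ) < a + 1 := by positivity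
    refine mul_left_cancel₀
      (by positivity : ((2 * (b : ℝ) + 1) * (a + 1) * (x + y + z)) ≠ 0) ?_
    have main : (2 * (b : ℝ) + 1) * (a + 1) * (x + y + z) *
        (triple (a + 1) b c * ((2 * (x + y + z) + 1) * coeff (x + y + z))) =
        (2 * a + 1) * ((b + 1) * (x + y + z) * (2 * (coeff (x + 1) * coeff (y - 1) * coeff z)) +
          (2 * (x + y + z) + 1) * (2 * b * (coeff x * coeff y * coeff (z - 1)))) -
        (2 * b + 1) * (2 * (x + y + z) + 1) *
          (2 * a * (coeff (x + 1) * coeff (y - 1) * coeff (z - 1))) := by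
      linear_combination ((x : ℝ) + y + z) * ((2 * (x + y + z) + 1) * coeff (x + y + z)) * hrec
        + (2 * (a : ℝ) + 1) * (b + 1) * (x + y + z) * h3
        + (2 * (a : ℝ) + 1) * (2 * (x + y + z) + 1) * h4
        - (2 * (b : ℝ) + 1) * (2 * (x + y + z) + 1) * h2
    rw [main, hX, hY, hZ, ha', hb']
    field_simp
    ring

lemma integral_poly_cube_pos {n : ℕ} (hn : Even n) : 0 < integral (poly n ^ 3) := by
  obtain ⟨m, rfl⟩ := hn
  have h := triple_mul_coeff (m + m) (m + m) (m + m) m m m (by push_cast; rfl) (by push_cast; rfl)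
    (by push_cast; rfl)
  have h1 : 0 < coeff (m : ℤ) := coeff_pos (by lia)
  have h2 : 0 < coeff ((m : ℤ) + m + m) := coeff_pos (by lia)
  rw [triple, ← pow_two, ← pow_succ] at h
  have h3 : 0 < 2 * (coeff (m : ℤ) * coeff (m : ℤ) * coeff (m : ℤ)) := by positivity
  rw [← h] at h3
  push_cast at h3
  exact pos_of_mul_pos_left h3 (by positivity)

lemma integral_poly_cube_eq_zero {n : ℕ} (hn : Odd n) : integral (poly n ^ 3) = 0 := by
  have h := integral_comp_neg_X (poly n ^ 3)
  rw [pow_comp, poly_comp_neg_X, hn.neg_one_pow, neg_one_mul, Odd.neg_pow (by decide), map_neg] at h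
  linarith

end Legendre

section RadialODE

/-- Uniqueness for `v'' + v'/r = g` with zero initial data when `|g| ≤ C |v|` on `(0, R)`. -/
lemma eq_zero_of_abs_radial_laplacian_le {v : ℝ → ℝ} {R C : ℝ} (hR : 0 ≤ R)
    (hv : ContDiffOn ℝ 2 v (Ici 0)) (h0 : v 0 = 0) (h0' : derivWithin v (Ici 0) 0 = 0)
    (hC : ∀ r ∈ Ioo 0 R, |deriv (deriv v) r + deriv v r / r| ≤ C * |v r|) : v R = 0 := by
  rcases hR.eq_or_lt with rfl | hR'
  · exact h0
  have hC0 : 0 ≤ |C| := abs_nonneg C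
  set E : ℝ → ℝ := fun r => (v r ^ 2 + derivWithin v (Ici 0) r ^ 2) * Real.exp (-(1 + |C|) * r)
  have hcont : ContinuousOn E (Icc 0 R) := by
    have h1 : ContinuousOn v (Icc 0 R) := hv.continuousOn.mono Icc_subset_Ici_self
    have h2 : ContinuousOn (derivWithin v (Ici 0)) (Icc 0 R) :=
      (hv.continuousOn_derivWithin (uniqueDiffOn_Ici 0) (by norm_num)).mono Icc_subset_Ici_self
    fun_prop
  have hderiv : ∀ r ∈ Ioo 0 R, HasDerivAt E
      ((2 * v r * deriv v r + 2 * deriv v r * deriv (deriv v) r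
        - (1 + |C|) * (v r ^ 2 + deriv v r ^ 2)) * Real.exp (-(1 + |C|) * r)) r := by
    intro r hr
    have hd : DifferentiableAt ℝ v r :=
      (hv.differentiableOn (by norm_num)).differentiableAt (Ici_mem_nhds hr.1)
    have hw : ContDiffOn ℝ 1 (deriv v) (Ioi 0) :=
      (hv.mono Ioi_subset_Ici_self).deriv_of_isOpen isOpen_Ioi (by norm_num)
    have hdd : DifferentiableAt ℝ (deriv v) r :=
      (hw.differentiableOn (by norm_num)).differentiableAt (Ioi_mem_nhds hr.1)
    have heq : derivWithin v (Ici 0) =ᶠ[nhds r] deriv v := by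
      filter_upwards [Ioi_mem_nhds hr.1] with t ht
      exact derivWithin_of_mem_nhds (Ici_mem_nhds ht)
    have hw' := hdd.hasDerivAt.congr_of_eventuallyEq heq
    have he : HasDerivAt (fun r => Real.exp (-(1 + |C|) * r))
        (Real.exp (-(1 + |C|) * r) * (-(1 + |C|))) r := by
      simpa using ((hasDerivAt_id r).const_mul (-(1 + |C|))).exp
    refine (((hd.hasDerivAt.pow 2).add (hw'.pow 2)).mul he).congr_deriv ?_
    simp only [heq.eq_of_nhds, Pi.add_apply, Pi.pow_apply]
    ring
  have hanti : AntitoneOn E (Icc 0 R) := by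
    refine antitoneOn_of_deriv_nonpos (convex_Icc 0 R) hcont ?_ ?_
    · rw [interior_Icc]
      exact fun r hr => (hderiv r hr).differentiableAt.differentiableWithinAt
    · rw [interior_Icc]
      intro r hr
      rw [(hderiv r hr).deriv]
      refine mul_nonpos_of_nonpos_of_nonneg ?_ (Real.exp_pos _).le
      set g := deriv (deriv v) r + deriv v r / r with hg
      have hg1 : |g| ≤ |C| * |v r| :=
        (hC r hr).trans (mul_le_mul_of_nonneg_right (le_abs_self C) (abs_nonneg _))
      have h1 : deriv (deriv v) r = g - deriv v r / r := by rw [hg]; ring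
      have h2 : 0 ≤ deriv v r * (deriv v r / r) := by
        rw [← mul_div_assoc]; exact div_nonneg (mul_self_nonneg _) hr.1.le
      have h3 : deriv v r * g ≤ |C| * (|v r| * |deriv v r|) := by
        calc deriv v r * g ≤ |deriv v r * g| := le_abs_self _
          _ = |deriv v r| * |g| := abs_mul _ _
          _ ≤ |deriv v r| * (|C| * |v r|) := by gcongr
          _ = _ := by ring
      have h4 : 2 * (|v r| * |deriv v r|) ≤ v r ^ 2 + deriv v r ^ 2 := by
        rw [← sq_abs (v r), ← sq_abs (deriv v r)]
        nlinarith [sq_nonneg (|v r| - |deriv v r|)]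
      have h5 : v r * deriv v r ≤ |v r| * |deriv v r| := (le_abs_self _).trans (abs_mul _ _).le
      rw [h1]
      nlinarith [mul_le_mul_of_nonneg_left h4 hC0]
  have hE := hanti (left_mem_Icc.2 hR) (right_mem_Icc.2 hR) hR
  have hE0 : E 0 = 0 := by simp [E, h0, h0']
  rw [hE0] at hE
  have h6 : v R ^ 2 + derivWithin v (Ici 0) R ^ 2 ≤ 0 :=
    nonpos_of_mul_nonpos_left hE (Real.exp_pos _)
  have h7 := sq_nonneg (derivWithin v (Ici 0) R)
  exact (sq_nonpos_iff (v R)).1 (by linarith)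

lemma abs_exp_sub_one_le_mul_exp_abs (t : ℝ) : |Real.exp t - 1| ≤ |t| * Real.exp |t| := by
  have h1 := Real.add_one_le_exp t
  have h2 := Real.add_one_le_exp (-t)
  have h3 : Real.exp t * Real.exp (-t) = 1 := by rw [← Real.exp_add]; simp
  have h4 : Real.exp t ≤ Real.exp |t| := Real.exp_le_exp.2 (le_abs_self t)
  have h5 : 1 ≤ Real.exp |t| := Real.one_le_exp (abs_nonneg t)
  have h6 := Real.exp_pos t
  rcases le_total 0 t with ht | ht
  · rw [abs_of_nonneg (sub_nonneg.2 (Real.one_le_exp ht)), abs_of_nonneg ht]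
    nlinarith
  · rw [abs_of_nonpos (sub_nonpos.2 (Real.exp_le_one_iff.2 ht)), abs_of_nonpos ht]
    rw [abs_of_nonpos ht] at h5
    nlinarith

lemma radial_laplacian_sub {f g : ℝ → ℝ} (hf : ContDiffOn ℝ 2 f (Ici 0)) (hg : ContDiff ℝ 2 g)
    {r : ℝ} (hr : 0 < r) :
    deriv (deriv (fun t => f t - g t)) r + deriv (fun t => f t - g t) r / r =
      (deriv (deriv f) r + deriv f r / r) - (deriv (deriv g) r + deriv g r / r) := by
  have hd : ∀ t, 0 < t → deriv (fun t => f t - g t) t = deriv f t - deriv g t := fun t ht =>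
    deriv_fun_sub ((hf.differentiableOn (by norm_num)).differentiableAt (Ici_mem_nhds ht))
      (hg.differentiable (by norm_num) t)
  have hf1 : ContDiffOn ℝ 1 (deriv f) (Ioi 0) :=
    (hf.mono Ioi_subset_Ici_self).deriv_of_isOpen isOpen_Ioi (by norm_num)
  have hg1 : ContDiffOn ℝ 1 (deriv g) (Ioi 0) :=
    hg.contDiffOn.deriv_of_isOpen isOpen_Ioi (by norm_num)
  have heq : deriv (fun t => f t - g t) =ᶠ[nhds r] fun t => deriv f t - deriv g t := by
    filter_upwards [Ioi_mem_nhds hr] with t ht using hd t ht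
  rw [heq.deriv_eq, hd r hr, deriv_fun_sub
    ((hf1.differentiableOn (by norm_num)).differentiableAt (Ioi_mem_nhds hr))
    ((hg1.differentiableOn (by norm_num)).differentiableAt (Ioi_mem_nhds hr))]
  ring

lemma derivWithin_sub_eq_zero {f g : ℝ → ℝ} (hf : ContDiffOn ℝ 2 f (Ici 0)) (hg : ContDiff ℝ 2 g)
    (hf0 : derivWithin f (Ici 0) 0 = 0) (hg0 : deriv g 0 = 0) :
    derivWithin (fun t => f t - g t) (Ici 0) 0 = 0 := by
  have hg' := hg.differentiable (by norm_num) 0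
  rw [derivWithin_fun_sub (hf.differentiableOn (by norm_num) 0 (self_mem_Ici))
    hg'.differentiableWithinAt, hf0, hg'.derivWithin (uniqueDiffOn_Ici 0 0 self_mem_Ici), hg0,
    sub_zero]

/-- The explicit solution of the Liouville equation. -/
def ustar (N r : ℝ) : ℝ :=
  (1 / 2) * Real.log (2 * (N + 2)) - (N + 2) / 2 * Real.log (1 + r ^ 2)

lemma contDiff_ustar (N : ℝ) : ContDiff ℝ 2 (ustar N) := by
  unfold ustar
  have : ContDiff ℝ 2 fun r : ℝ => Real.log (1 + r ^ 2) :=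
    ContDiff.log (by fun_prop) fun r => by positivity
  fun_prop

lemma hasDerivAt_ustar (N r : ℝ) : HasDerivAt (ustar N) (-(N + 2) * (r / (1 + r ^ 2))) r := by
  have h : HasDerivAt (fun r : ℝ => 1 + r ^ 2) (2 * r) r := by
    simpa using (hasDerivAt_pow 2 r).const_add 1
  refine ((h.log (by positivity)).const_mul ((N + 2) / 2)).const_sub
    ((1 / 2) * Real.log (2 * (N + 2))) |>.congr_deriv ?_
  ring

lemma radial_laplacian_ustar (N : ℝ) {r : ℝ} (hr : 0 < r) :
    deriv (deriv (ustar N)) r + deriv (ustar N) r / r = -(2 * (N + 2) / (1 + r ^ 2) ^ 2) := by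
  have h : deriv (ustar N) = fun r => -(N + 2) * (r / (1 + r ^ 2)) :=
    funext fun r => (hasDerivAt_ustar N r).deriv
  have hq : HasDerivAt (fun r : ℝ => 1 + r ^ 2) (2 * r) r := by
    simpa using (hasDerivAt_pow 2 r).const_add 1
  have h2 := (((hasDerivAt_id' r).fun_div hq (by positivity)).const_mul (-(N + 2))).deriv
  rw [h, h2]
  field_simp
  ring

lemma weight_mul_exp_ustar {N : ℝ} (hN : 0 < N + 2) (r : ℝ) :
    (1 + r ^ 2) ^ N * Real.exp (2 * ustar N r) = 2 * (N + 2) / (1 + r ^ 2) ^ 2 := by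
  have hr : 0 < 1 + r ^ 2 := by positivity
  have h : 2 * ustar N r = Real.log (2 * (N + 2)) + Real.log (1 + r ^ 2) * (-(N + 2)) := by
    unfold ustar; ring
  rw [h, Real.exp_add, Real.exp_log (by positivity), ← Real.rpow_def_of_pos hr,
    mul_left_comm, ← Real.rpow_add hr, show N + -(N + 2) = -2 by ring, Real.rpow_neg hr.le,
    Real.rpow_ofNat]
  rfl

lemma IsSol.eq_ustar {N : ℝ} (hN : 0 < N + 2) {u : ℝ → ℝ} (hu : IsSol N u)
    (hu0 : u 0 = (1 / 2) * Real.log (2 * (N + 2))) {R : ℝ} (hR : 0 ≤ R) : u R = ustar N R := by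
  obtain ⟨hc, heq, hd0, -⟩ := hu
  have hs := contDiff_ustar N
  have hvc : ContDiffOn ℝ 2 (fun r => u r - ustar N r) (Ici 0) := hc.sub hs.contDiffOn
  obtain ⟨B, hB⟩ := isCompact_Icc.exists_bound_of_continuousOn
    (hvc.continuousOn.mono (Icc_subset_Ici_self : Icc 0 R ⊆ Ici 0))
  refine sub_eq_zero.1 (eq_zero_of_abs_radial_laplacian_le
    (v := fun r => u r - ustar N r) (C := 2 * (N + 2) * (2 * Real.exp (2 * B))) hR hvc ?_ ?_ fun r hr => ?_)
  · simp [hu0, ustar]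
  · exact derivWithin_sub_eq_zero hc hs hd0 (by rw [(hasDerivAt_ustar N 0).deriv]; simp)
  · rw [radial_laplacian_sub hc hs hr.1, radial_laplacian_ustar N hr.1]
    have hBr := hB r ⟨hr.1.le, hr.2.le⟩
    rw [Real.norm_eq_abs] at hBr
    have h1 := heq r hr.1
    have h2 := weight_mul_exp_ustar hN r
    have h3 : Real.exp (2 * u r) =
        Real.exp (2 * ustar N r) * Real.exp (2 * (u r - ustar N r)) := by
      rw [← Real.exp_add]; congr 1; ring
    have h4 : deriv (deriv u) r + deriv u r / r - -(2 * (N + 2) / (1 + r ^ 2) ^ 2) =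
        -(2 * (N + 2) / (1 + r ^ 2) ^ 2 * (Real.exp (2 * (u r - ustar N r)) - 1)) := by
      rw [h3, ← mul_assoc, h2] at h1
      linear_combination h1
    have h5 : 2 * (N + 2) / (1 + r ^ 2) ^ 2 ≤ 2 * (N + 2) :=
      div_le_self (by positivity) (one_le_pow₀ (by nlinarith [sq_nonneg r]))
    rw [h4, abs_neg, abs_mul, abs_of_nonneg (by positivity)]
    calc _ ≤ 2 * (N + 2) * (|2 * (u r - ustar N r)| * Real.exp |2 * (u r - ustar N r)|) :=
          mul_le_mul h5 (abs_exp_sub_one_le_mul_exp_abs _) (abs_nonneg _) (by positivity)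
      _ ≤ 2 * (N + 2) * (2 * |u r - ustar N r| * Real.exp (2 * B)) := by
          rw [abs_mul, abs_two]; gcongr
      _ = _ := by ring

/-- The height coordinate of stereographic projection. -/
def stereo (r : ℝ) : ℝ := (1 - r ^ 2) / (1 + r ^ 2)

lemma hasDerivAt_stereo (r : ℝ) : HasDerivAt stereo (-(4 * r) / (1 + r ^ 2) ^ 2) r := by
  have hq : HasDerivAt (fun r : ℝ => 1 + r ^ 2) (2 * r) r := by
    simpa using (hasDerivAt_pow 2 r).const_add 1
  have hp : HasDerivAt (fun r : ℝ => 1 - r ^ 2) (-(2 * r)) r := by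
    simpa using (hasDerivAt_pow 2 r).const_sub 1
  refine (hp.fun_div hq (by positivity)).congr_deriv ?_
  ring

lemma contDiff_stereo : ContDiff ℝ 2 stereo :=
  ContDiff.div (by fun_prop) (by fun_prop) fun r => by positivity

open Polynomial in
lemma radial_laplacian_legendre (n : ℕ) {r : ℝ} (hr : 0 < r) :
    deriv (deriv fun t => (Legendre.poly n).eval (stereo t)) r +
      deriv (fun t => (Legendre.poly n).eval (stereo t)) r / r =
      -(4 * (n * (n + 1)) / (1 + r ^ 2) ^ 2 * (Legendre.poly n).eval (stereo r)) := by
  have h : deriv (fun t => (Legendre.poly n).eval (stereo t)) =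
      fun r => (derivative (Legendre.poly n)).eval (stereo r) * (-(4 * r) / (1 + r ^ 2) ^ 2) :=
    funext fun r => (((Legendre.poly n).hasDerivAt _).comp r (hasDerivAt_stereo r)).deriv
  have hq : HasDerivAt (fun r : ℝ => (1 + r ^ 2) ^ 2) (2 * (1 + r ^ 2) * (2 * r)) r := by
    have : HasDerivAt (fun r : ℝ => 1 + r ^ 2) (2 * r) r := by
      simpa using (hasDerivAt_pow 2 r).const_add 1
    simpa using this.fun_pow 2
  have hp : HasDerivAt (fun r : ℝ => -(4 * r)) (-4) r := by
    simpa using ((hasDerivAt_id' r).const_mul 4).fun_neg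
  have h2 := ((((derivative (Legendre.poly n)).hasDerivAt _).comp r (hasDerivAt_stereo r)).mul
    (hp.fun_div hq (by positivity))).deriv
  have hode := congrArg (eval (stereo r)) (Legendre.derivative_sq_sub_one_mul n)
  simp only [derivative_mul, derivative_sub, derivative_X_pow, derivative_one, eval_add, eval_mul,
    eval_sub, eval_pow, eval_X, eval_one, eval_natCast, eval_C, eval_zero] at hode
  have hs : stereo r = (1 - r ^ 2) / (1 + r ^ 2) := rfl
  rw [h]
  refine (congrArg (· + _) h2).trans ?_
  simp only [Function.comp_apply]
  set p0 := (Legendre.poly n).eval (stereo r)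
  set p1 := (derivative (Legendre.poly n)).eval (stereo r)
  set p2 := (derivative (derivative (Legendre.poly n))).eval (stereo r)
  rw [hs, show 2 - 1 = 1 from rfl, pow_one, Nat.cast_ofNat, sub_zero] at hode
  linear_combination (norm := (field_simp; ring)) (-4 / (1 + r ^ 2) ^ 2) * hode

lemma IsLin.eq_legendre {k : ℕ} {N : ℝ} (hN : N = (k : ℝ) * (k + 1) - 2) (hN0 : 0 < N + 2)
    {u φ : ℝ → ℝ} (hu : IsSol N u)
    (hu0 : u 0 = (1 / 2) * Real.log (2 * (N + 2))) (hφ : IsLin N u φ) {R : ℝ} (hR : 0 ≤ R) :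
    φ R = (Legendre.poly k).eval (stereo R) := by
  obtain ⟨hc, heq, h0, hd0⟩ := hφ
  have hs : ContDiff ℝ 2 fun t => (Legendre.poly k).eval (stereo t) :=
    (by simpa using (Legendre.poly k).contDiff_aeval (𝕜 := ℝ) 2 : ContDiff ℝ 2
      fun x => (Legendre.poly k).eval x).comp contDiff_stereo
  have hs0 := (((Legendre.poly k).hasDerivAt _).comp 0 (hasDerivAt_stereo 0)).deriv
  refine sub_eq_zero.1 (eq_zero_of_abs_radial_laplacian_le
    (v := fun t => φ t - (Legendre.poly k).eval (stereo t))
    (C := 4 * (N + 2)) hR (hc.sub hs.contDiffOn) ?_ ?_ fun r hr => ?_)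
  · simp [h0, stereo, Legendre.eval_one_poly]
  · exact derivWithin_sub_eq_zero hc hs hd0 (hs0.trans (by simp))
  · rw [radial_laplacian_sub hc hs hr.1, radial_laplacian_legendre k hr.1]
    have h1 := heq r hr.1
    rw [mul_assoc 2, hu.eq_ustar hN0 hu0 hr.1.le, weight_mul_exp_ustar hN0] at h1
    have hk : (k : ℝ) * (k + 1) = N + 2 := by rw [hN]; ring
    rw [hk]
    have h4 : deriv (deriv φ) r + deriv φ r / r -
        -(4 * (N + 2) / (1 + r ^ 2) ^ 2 * (Legendre.poly k).eval (stereo r)) =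
        -(4 * (N + 2) / (1 + r ^ 2) ^ 2 * (φ r - (Legendre.poly k).eval (stereo r))) := by
      linear_combination h1
    have h5 : 4 * (N + 2) / (1 + r ^ 2) ^ 2 ≤ 4 * (N + 2) :=
      div_le_self (by positivity) (one_le_pow₀ (by nlinarith [sq_nonneg r]))
    rw [h4, abs_neg, abs_mul, abs_of_nonneg (by positivity)]
    gcongr

lemma stereo_image_Ioi : stereo '' Ioi 0 = Ioo (-1) 1 := by
  ext s
  constructor
  · rintro ⟨r, hr, rfl⟩
    have hr' : 0 < r := hr
    have : 0 < 1 + r ^ 2 := by positivity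
    constructor
    · rw [stereo, lt_div_iff₀ this]; linarith
    · rw [stereo, div_lt_iff₀ this]; nlinarith
  · rintro ⟨h1, h2⟩
    have h3 : 0 < 1 + s := by linarith
    have h4 : 0 < (1 - s) / (1 + s) := div_pos (by linarith) h3
    refine ⟨√((1 - s) / (1 + s)), Real.sqrt_pos.2 h4, ?_⟩
    rw [stereo, Real.sq_sqrt h4.le]
    field_simp
    ring

lemma injOn_stereo : InjOn stereo (Ioi 0) := by
  intro a ha b hb h
  have ha' : 0 < a := ha
  have hb' : 0 < b := hb
  rw [stereo, stereo, div_eq_div_iff (by positivity) (by positivity)] at h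
  exact (pow_left_inj₀ ha'.le hb'.le two_ne_zero).1 (by linarith)

lemma integral_stereo (g : ℝ → ℝ) :
    ∫ r in Ioi (0 : ℝ), 4 * r / (1 + r ^ 2) ^ 2 * g (stereo r) = ∫ s in (-1 : ℝ)..1, g s := by
  rw [intervalIntegral.integral_of_le (by norm_num), integral_Ioc_eq_integral_Ioo,
    ← stereo_image_Ioi, integral_image_eq_integral_abs_deriv_smul measurableSet_Ioi
      (fun r _ => (hasDerivAt_stereo r).hasDerivWithinAt) injOn_stereo]
  refine setIntegral_congr_fun measurableSet_Ioi fun r hr => ?_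
  have hr' : 0 < r := hr
  simp only [smul_eq_mul]
  rw [neg_div, abs_neg, abs_of_nonneg (by positivity)]

end RadialODE

/-- For `k ≥ 2`, `N = N_k = k(k+1) − 2` and `a*_N = ½ log(2(N+2))`, one has
`j(k) = J_{N_k}(a*_{N_k}) = ½ k(k+1) ∫_{−1}^1 P_k(s)³ ds`, hence `j(k) = 0` for odd
`k` and `j(k) > 0` for even `k`. -/
theorem JN_at_ustar (k : ℕ) (hk : 2 ≤ k) (N : ℝ) (hN : N = (k : ℝ) * (k + 1) - 2)
    (u φ : ℝ → ℝ) (hu : IsSol N u) (hu0 : u 0 = (1 / 2) * Real.log (2 * (N + 2)))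
    (hφ : IsLin N u φ) :
    (JN N u φ = (1 / 2) * (k : ℝ) * (k + 1) * ∫ s in (-1:ℝ)..1, (legP k s) ^ 3) ∧
    (Odd k → JN N u φ = 0) ∧ (Even k → 0 < JN N u φ) := by
  have hN0 : 0 < N + 2 := by
    have : (0 : ℝ) < k := by exact_mod_cast (by lia : 0 < k)
    rw [hN, sub_add_cancel]
    positivity
  have hJ : JN N u φ = (1 / 2) * (k : ℝ) * (k + 1) * ∫ s in (-1:ℝ)..1, (legP k s) ^ 3 := by
    rw [← integral_stereo, ← integral_const_mul]
    refine setIntegral_congr_fun measurableSet_Ioi fun r hr => ?_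
    have hr' : (0 : ℝ) ≤ r := (mem_Ioi.1 hr).le
    have hk : (k : ℝ) * (k + 1) = N + 2 := by rw [hN]; ring
    rw [hφ.eq_legendre hN hN0 hu hu0 hr', hu.eq_ustar hN0 hu0 hr', weight_mul_exp_ustar hN0,
      Legendre.legP_eq_eval, ← hk]
    ring
  have hI : ∫ s in (-1:ℝ)..1, (legP k s) ^ 3 = Legendre.integral (Legendre.poly k ^ 3) := by
    simp only [Legendre.integral_apply, Legendre.legP_eq_eval, Polynomial.eval_pow]
  refine ⟨hJ, fun hodd => ?_, fun heven => ?_⟩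
  · rw [hJ, hI, Legendre.integral_poly_cube_eq_zero hodd, mul_zero]
  · rw [hJ, hI]
    have := Legendre.integral_poly_cube_pos heven
    have : (0 : ℝ) < k := by exact_mod_cast (by lia : 0 < k)
    positivity
end
end
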